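/- Let (Ω, C, Λ) be a naive convex co-compact triple such that cdim_{F_Ω(x)}(∂_i C ∩ F_Ω(x)) ≤ 1 for all x ∈ ∂_i C. If ℓ ⊂ ∂_i C is a line segment, S ⊂ C is a properly embedded two-dimensional simplex, and ℓ intersects F_Ω(∂S) := ⋃_{x ∈ ∂S} F_Ω(x), then ℓ ⊂ F_Ω(∂S). -/

import Mathlib

open Set Filter

noncomputable section

/-- Real projective space `P(ℝ^d)`, with the quotient topology. -/
abbrev PSpace (d : ℕ) := Projectivization ℝ (Fin d → ℝ)

instance PSpace.instTopologicalSpace (d : ℕ) : TopologicalSpace (PSpace d) :=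
  inferInstanceAs (TopologicalSpace (Quotient (projectivizationSetoid ℝ (Fin d → ℝ))))

namespace Paper

variable {d : ℕ}

/-- Inhomogeneous coordinates in the affine chart determined by the linear functional `f`:
a projective point `[v]` with `f v ≠ 0` is sent to the representative `v / f v` lying in the
affine hyperplane `{f = 1}`. -/
def chartMap (f : (Fin d → ℝ) →ₗ[ℝ] ℝ) (x : PSpace d) : Fin d → ℝ :=
  (f x.rep)⁻¹ • x.rep

/-- A subset of `P(ℝ^d)` is properly convex if there is an affine chart in which it is a
bounded convex set. -/
def IsProperlyConvex (C : Set (PSpace d)) : Prop :=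
  ∃ f : (Fin d → ℝ) →ₗ[ℝ] ℝ, (∀ x ∈ closure C, f x.rep ≠ 0) ∧
    Convex ℝ (chartMap f '' C) ∧ Bornology.IsBounded (chartMap f '' C)

/-- A properly convex domain: an open, nonempty, properly convex subset of `P(ℝ^d)`. -/
def IsPCDomain (Ω : Set (PSpace d)) : Prop :=
  IsOpen Ω ∧ Ω.Nonempty ∧ IsProperlyConvex Ω

open Classical in
/-- A choice of an affine chart containing the properly convex set `C`. -/
def chartOf (C : Set (PSpace d)) : (Fin d → ℝ) →ₗ[ℝ] ℝ :=
  if h : IsProperlyConvex C then h.choose else 0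

/-- The chart map associated to the chosen chart of `C`. -/
def cmap (C : Set (PSpace d)) : PSpace d → Fin d → ℝ := chartMap (chartOf C)

/-- The Hilbert distance between `u` and `v` computed in an affine chart where the convex set
is `O`: writing the line through `u, v` as `t ↦ u + t(v-u)`, with boundary parameters
`tm = inf {t | u + t(v-u) ∈ O} ≤ 0` and `tp = sup {...} ≥ 1`, the cross-ratio
`[a,u,v,b]` of `a = u + tm(v-u), u, v, b = u + tp(v-u)` equals `(tp(1-tm))/((-tm)(tp-1))`. -/
def hilbertDistChart (O : Set (Fin d → ℝ)) (u v : Fin d → ℝ) : ℝ :=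
  if u = v then 0
  else
    (1 / 2) * Real.log
      ((sSup {t : ℝ | u + t • (v - u) ∈ O} * (1 - sInf {t : ℝ | u + t • (v - u) ∈ O})) /
        ((-(sInf {t : ℝ | u + t • (v - u) ∈ O})) * (sSup {t : ℝ | u + t • (v - u) ∈ O} - 1)))

/-- The Hilbert metric of a properly convex set `C` (open in its span). -/
def hilbertDist (C : Set (PSpace d)) (x y : PSpace d) : ℝ :=
  hilbertDistChart (cmap C '' C) (cmap C x) (cmap C y)

/-- The closed projective line segment `[x,y]` contained in `closure C`. -/
def projSeg (C : Set (PSpace d)) (x y : PSpace d) : Set (PSpace d) :=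
  {z ∈ closure C | cmap C z ∈ segment ℝ (cmap C x) (cmap C y)}

/-- The open projective line segment `(x,y)` contained in `closure C`. -/
def projOpenSeg (C : Set (PSpace d)) (x y : PSpace d) : Set (PSpace d) :=
  {z ∈ closure C | cmap C z ∈ openSegment ℝ (cmap C x) (cmap C y)}

/-- The open face `F_C(x)` of a point `x ∈ closure C`: the set `{x}` together with all
`y ∈ closure C` such that some open line segment contained in `closure C` contains
both `x` and `y`. -/
def face (C : Set (PSpace d)) (x : PSpace d) : Set (PSpace d) :=
  insert x {y ∈ closure C | ∃ a ∈ closure C, ∃ b ∈ closure C,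
    x ∈ projOpenSeg C a b ∧ y ∈ projOpenSeg C a b}

/-- The ideal boundary `∂_i C = closure C \ C`. -/
def idealBdry (C : Set (PSpace d)) : Set (PSpace d) := closure C \ C

/-- The dimension of a subset `B`, computed in the chart of the ambient convex set `C`. -/
def pdimIn (C B : Set (PSpace d)) : ℕ :=
  Module.finrank ℝ (affineSpan ℝ (cmap C '' B)).direction

/-- The dimension of a convex subset of `P(ℝ^d)`. -/
def pdim (A : Set (PSpace d)) : ℕ := pdimIn A A

/-- The coarse dimension `cdim_C(A)` of a nonempty subset `A` of a properly convex set `C`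
open in its span: the smallest `k` such that `A` is contained in an `R`-neighborhood (for the
Hilbert metric of `C`) of a `k`-dimensional convex subset `B ⊆ C`. -/
def cdim (C A : Set (PSpace d)) : ℕ :=
  sInf {k : ℕ | ∃ R : ℝ, 0 < R ∧ ∃ B : Set (PSpace d), B ⊆ C ∧
    Convex ℝ (cmap C '' B) ∧ pdimIn C B = k ∧
    A ⊆ {p ∈ C | ∃ q ∈ B, hilbertDist C p q < R}}

/-- The cone over the standard open `(p-1)`-dimensional simplex: vectors whose first `p`
coordinates are positive and whose remaining coordinates vanish. -/
def simplexCone (p : ℕ) : Set (Fin d → ℝ) :=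
  {v | (∀ i : Fin d, (i : ℕ) < p → 0 < v i) ∧ ∀ i : Fin d, p ≤ (i : ℕ) → v i = 0}

/-- `S` is the image under `g ∈ PGL_d(ℝ)` of the standard open simplex with `p` vertices. -/
def IsSimplexWithMap (p : ℕ) (S : Set (PSpace d)) (g : (Fin d → ℝ) ≃ₗ[ℝ] (Fin d → ℝ)) : Prop :=
  S = {q : PSpace d | ∃ v ∈ simplexCone (d := d) p, ∃ hv : v ≠ 0,
        q = Projectivization.mk ℝ (g v) (by simpa using hv)}

/-- `S ⊆ P(ℝ^d)` is a simplex of dimension `k`. -/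
def IsSimplexOfDim (k : ℕ) (S : Set (PSpace d)) : Prop :=
  k + 1 ≤ d ∧ ∃ g : (Fin d → ℝ) ≃ₗ[ℝ] (Fin d → ℝ), IsSimplexWithMap (k + 1) S g

/-- `S` is a simplex with vertices `v 0, …, v (p-1)` (so of dimension `p - 1`). -/
def HasVertices {p : ℕ} (S : Set (PSpace d)) (v : Fin p → PSpace d) : Prop :=
  ∃ (hp : p ≤ d) (g : (Fin d → ℝ) ≃ₗ[ℝ] (Fin d → ℝ)),
    IsSimplexWithMap p S g ∧
    ∀ j : Fin p, v j = Projectivization.mk ℝ (g (Pi.single (Fin.castLE hp j) 1))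
      (by
        simp only [ne_eq, EmbeddingLike.map_eq_zero_iff]
        intro h
        have h1 := congrFun h (Fin.castLE hp j)
        rw [Pi.single_eq_same] at h1
        exact one_ne_zero (α := ℝ) h1)

/-- `A ⊆ B` is properly embedded if the inclusion map `A ↪ B` is proper. -/
def IsProperlyEmbedded (A B : Set (PSpace d)) : Prop :=
  ∃ h : A ⊆ B, IsProperMap (Set.inclusion h)

/-- The projective action of `GL(ℝ^d)` (hence of `PGL_d(ℝ)`) on `P(ℝ^d)`. -/
def pact (g : (Fin d → ℝ) ≃ₗ[ℝ] (Fin d → ℝ)) : PSpace d → PSpace d :=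
  Projectivization.map g.toLinearMap g.injective

/-- A naive convex co-compact triple `(Ω, C, Λ)`. -/
structure NCCTriple (d : ℕ) where
  Ω : Set (PSpace d)
  C : Set (PSpace d)
  Λ : Subgroup ((Fin d → ℝ) ≃ₗ[ℝ] (Fin d → ℝ))
  isOpen_Ω : IsOpen Ω
  nonempty_Ω : Ω.Nonempty
  properlyConvex_Ω : IsProperlyConvex Ω
  inv_Ω : ∀ g ∈ Λ, pact g '' Ω = Ω
  infinite_Λ : (Λ : Set ((Fin d → ℝ) ≃ₗ[ℝ] (Fin d → ℝ))).Infinite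
  discrete_Λ : ∀ K ⊆ Ω, IsCompact K →
    {g : (Fin d → ℝ) ≃ₗ[ℝ] (Fin d → ℝ) | g ∈ Λ ∧ (pact g '' K ∩ K).Nonempty}.Finite
  C_nonempty : C.Nonempty
  C_sub : C ⊆ Ω
  C_closedInΩ : closure C ∩ Ω ⊆ C
  C_convex : Convex ℝ (cmap Ω '' C)
  inv_C : ∀ g ∈ Λ, pact g '' C = C
  cocompact : ∃ K : Set (PSpace d), K ⊆ C ∧ IsCompact K ∧ C ⊆ ⋃ g ∈ Λ, pact g '' K

/-- The orbit of a point under a subgroup of `PGL_d(ℝ)`. -/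
def porbit (Λ : Subgroup ((Fin d → ℝ) ≃ₗ[ℝ] (Fin d → ℝ))) (p : PSpace d) : Set (PSpace d) :=
  {q | ∃ g ∈ Λ, q = pact g p}

/-- The full orbital limit set `L_Ω(Λ)`. -/
def limitSet (Ω : Set (PSpace d)) (Λ : Subgroup ((Fin d → ℝ) ≃ₗ[ℝ] (Fin d → ℝ))) :
    Set (PSpace d) :=
  ⋃ p ∈ Ω, (closure (porbit Λ p) \ porbit Λ p)

/-- The convex hull of `X ⊆ closure Ω` taken inside `Ω`. -/
def convHullIn (Ω X : Set (PSpace d)) : Set (PSpace d) :=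
  {z ∈ Ω | cmap Ω z ∈ convexHull ℝ (cmap Ω '' X)}

/-- `C_Ω(Λ)`: the convex hull of the full orbital limit set in `Ω`. -/
def coreC (Ω : Set (PSpace d)) (Λ : Subgroup ((Fin d → ℝ) ≃ₗ[ℝ] (Fin d → ℝ))) :
    Set (PSpace d) :=
  convHullIn Ω (limitSet Ω Λ)

/-- A convex co-compact group `Λ ⊆ Aut(Ω)`: an infinite discrete subgroup preserving `Ω`
such that `C_Ω(Λ)` is nonempty and `Λ` acts cocompactly on it. -/
structure CCSetup (d : ℕ) where
  Ω : Set (PSpace d)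
  Λ : Subgroup ((Fin d → ℝ) ≃ₗ[ℝ] (Fin d → ℝ))
  isOpen_Ω : IsOpen Ω
  nonempty_Ω : Ω.Nonempty
  properlyConvex_Ω : IsProperlyConvex Ω
  inv_Ω : ∀ g ∈ Λ, pact g '' Ω = Ω
  infinite_Λ : (Λ : Set ((Fin d → ℝ) ≃ₗ[ℝ] (Fin d → ℝ))).Infinite
  discrete_Λ : ∀ K ⊆ Ω, IsCompact K →
    {g : (Fin d → ℝ) ≃ₗ[ℝ] (Fin d → ℝ) | g ∈ Λ ∧ (pact g '' K ∩ K).Nonempty}.Finite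
  core_nonempty : (coreC Ω Λ).Nonempty
  cocompact : ∃ K : Set (PSpace d), K ⊆ coreC Ω Λ ∧ IsCompact K ∧
    coreC Ω Λ ⊆ ⋃ g ∈ Λ, pact g '' K

/-- The Gromov product of `x, y` at `w`, with respect to the Hilbert metric of `Ω`. -/
def gromovProd (Ω : Set (PSpace d)) (w x y : PSpace d) : ℝ :=
  (hilbertDist Ω x w + hilbertDist Ω y w - hilbertDist Ω x y) / 2

/-- `(C, d_Ω)` is Gromov hyperbolic. -/
def GromovHyperbolicOn (Ω C : Set (PSpace d)) : Prop :=
  ∃ δ : ℝ, 0 ≤ δ ∧ ∀ x ∈ C, ∀ y ∈ C, ∀ z ∈ C, ∀ w ∈ C,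
    min (gromovProd Ω w x y) (gromovProd Ω w y z) - δ ≤ gromovProd Ω w x z

/-- The open Hilbert-metric ball in `Ω`. -/
def hBall (Ω : Set (PSpace d)) (x : PSpace d) (r : ℝ) : Set (PSpace d) :=
  {y ∈ Ω | hilbertDist Ω x y < r}

/-- The Hausdorff distance between `A` and `B` (w.r.t. the Hilbert metric of `Ω`)
is less than `ε`. -/
def hausLT (Ω A B : Set (PSpace d)) (ε : ℝ) : Prop :=
  (∀ a ∈ A, ∃ b ∈ B, hilbertDist Ω a b < ε) ∧ ∀ b ∈ B, ∃ a ∈ A, hilbertDist Ω a b < ε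

/-- The Hausdorff distance between `A` and `B` (w.r.t. the Hilbert metric of `Ω`)
is at most `r`. -/
def hausdorffDistLE (Ω A B : Set (PSpace d)) (r : ℝ) : Prop :=
  ∀ ε : ℝ, 0 < ε → hausLT Ω A B (r + ε)

/-- Convergence `F n → C` in the local Hausdorff topology induced by `d_Ω`. -/
def LocalHausConv (Ω : Set (PSpace d)) (F : ℕ → Set (PSpace d)) (C : Set (PSpace d)) : Prop :=
  ∀ x ∈ Ω, ∀ r : ℝ, 0 < r → ∀ ε : ℝ, 0 < ε →
    ∀ᶠ n in atTop, hausLT Ω (F n ∩ hBall Ω x r) (C ∩ hBall Ω x r) ε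

/-- A collection `𝒮` of closed subsets of `Ω` is closed and discrete in the local Hausdorff
topology: any sequence in `𝒮` converging to a nonempty closed subset of `Ω` has limit in `𝒮`
and is eventually equal to its limit. -/
def ClosedAndDiscreteInLHT (Ω : Set (PSpace d)) (𝒮 : Set (Set (PSpace d))) : Prop :=
  ∀ F : ℕ → Set (PSpace d), (∀ n, F n ∈ 𝒮) →
    ∀ C : Set (PSpace d), C.Nonempty → C ⊆ Ω → closure C ∩ Ω ⊆ C → LocalHausConv Ω F C →
      C ∈ 𝒮 ∧ ∀ᶠ n in atTop, F n = C

section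

structure Cset (d : ℕ) where
  I : Set (Fin d → ℝ)
  KC : Set (Fin d → ℝ)
  f : (Fin d → ℝ) →ₗ[ℝ] ℝ
  M : ℝ
  Iopen : IsOpen I
  Ine : I.Nonempty
  Iadd : ∀ u ∈ I, ∀ v ∈ I, u + v ∈ I
  Ismul : ∀ t : ℝ, 0 < t → ∀ u ∈ I, t • u ∈ I
  fpos : ∀ u ∈ I, 0 < f u
  fbd : ∀ u ∈ I, ‖u‖ ≤ M * f u
  KCclosed : IsClosed KC
  KCadd : ∀ u ∈ KC, ∀ v ∈ KC, u + v ∈ KC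
  KCsmul : ∀ t : ℝ, 0 ≤ t → ∀ u ∈ KC, t • u ∈ KC
  KCsub : KC ⊆ closure I

namespace Cset
variable (T : Cset d)

def K : Set (Fin d → ℝ) := closure T.I

theorem fcont : Continuous T.f := T.f.continuous_of_finiteDimensional

theorem Kcl : IsClosed T.K := isClosed_closure

theorem IK {u : Fin d → ℝ} (h : u ∈ T.I) : u ∈ T.K := subset_closure h

theorem Kadd {u v : Fin d → ℝ} (hu : u ∈ T.K) (hv : v ∈ T.K) : u + v ∈ T.K :=
  map_mem_closure₂ continuous_add hu hv T.Iadd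

theorem Ksmul0 {t : ℝ} (ht : 0 < t) {u : Fin d → ℝ} (hu : u ∈ T.K) : t • u ∈ T.K :=
  map_mem_closure (continuous_const_smul t) hu (T.Ismul t ht)

theorem Kzero : (0 : Fin d → ℝ) ∈ T.K := by
  obtain ⟨u, hu⟩ := T.Ine
  have h : Tendsto (fun n : ℕ => (1 / ((n : ℝ) + 1)) • u) atTop (nhds ((0 : ℝ) • u)) :=
    tendsto_one_div_add_atTop_nhds_zero_nat.smul_const u
  rw [zero_smul] at h
  exact mem_closure_of_tendsto h (Eventually.of_forall fun n => T.Ismul _ (by positivity) u hu)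

theorem Ksmul {t : ℝ} (ht : 0 ≤ t) {u : Fin d → ℝ} (hu : u ∈ T.K) : t • u ∈ T.K := by
  rcases ht.eq_or_lt with h | h
  · rw [← h, zero_smul]; exact T.Kzero
  · exact T.Ksmul0 h hu

theorem IaddK {u v : Fin d → ℝ} (hu : u ∈ T.I) (hv : v ∈ T.K) : u + v ∈ T.I := by
  have h1 : IsOpen {w : Fin d → ℝ | u + v - w ∈ T.I} :=
    T.Iopen.preimage (continuous_const.sub continuous_id)
  obtain ⟨w, hw1, hw2⟩ := mem_closure_iff.1 hv _ h1 (by simpa using hu)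
  have := T.Iadd _ hw1 _ hw2
  simpa using this

theorem KaddI {u v : Fin d → ℝ} (hu : u ∈ T.K) (hv : v ∈ T.I) : u + v ∈ T.I := by
  rw [add_comm]; exact T.IaddK hv hu

theorem Kbd {u : Fin d → ℝ} (hu : u ∈ T.K) : ‖u‖ ≤ T.M * T.f u := by
  have hc : IsClosed {u : Fin d → ℝ | ‖u‖ ≤ T.M * T.f u} :=
    isClosed_le continuous_norm (continuous_const.mul T.fcont)
  exact closure_minimal T.fbd hc hu

theorem Kf {u : Fin d → ℝ} (hu : u ∈ T.K) : 0 ≤ T.f u := by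
  have hc : IsClosed {u : Fin d → ℝ | 0 ≤ T.f u} := isClosed_le continuous_const T.fcont
  exact closure_minimal (fun u h => (T.fpos u h).le) hc hu

theorem Kfpos {u : Fin d → ℝ} (hu : u ∈ T.K) (h0 : u ≠ 0) : 0 < T.f u := by
  refine lt_of_le_of_ne (T.Kf hu) fun h => h0 ?_
  have := T.Kbd hu
  rw [← h, mul_zero] at this
  exact norm_le_zero_iff.1 this

theorem Kneg {u : Fin d → ℝ} (hu : u ∈ T.K) (hu' : -u ∈ T.K) : u = 0 := by
  by_contra h
  have h1 := T.Kfpos hu h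
  have h2 := T.Kf hu'
  rw [map_neg] at h2
  linarith

theorem Isub {u : Fin d → ℝ} (hu : u ∈ T.I) (w : Fin d → ℝ) : ∃ t : ℝ, 0 < t ∧ u - t • w ∈ T.I := by
  have h : Tendsto (fun n : ℕ => u - (1 / ((n : ℝ) + 1)) • w) atTop (nhds (u - (0 : ℝ) • w)) :=
    tendsto_const_nhds.sub (tendsto_one_div_add_atTop_nhds_zero_nat.smul_const w)
  rw [zero_smul, sub_zero] at h
  obtain ⟨n, hn⟩ := (h.eventually (T.Iopen.mem_nhds hu)).exists
  exact ⟨_, by positivity, hn⟩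

def Le (u v : Fin d → ℝ) : Prop := ∃ t : ℝ, 0 < t ∧ v - t • u ∈ T.K

theorem Le.trans {T : Cset d} {u v w : Fin d → ℝ} (h1 : T.Le u v) (h2 : T.Le v w) : T.Le u w := by
  obtain ⟨s, hs, h1⟩ := h1
  obtain ⟨t, ht, h2⟩ := h2
  refine ⟨t * s, by positivity, ?_⟩
  have := T.Kadd h2 (T.Ksmul ht.le h1)
  convert this using 1
  module

theorem le_refl (u : Fin d → ℝ) : T.Le u u := ⟨1, one_pos, by simpa using T.Kzero⟩

theorem le_add_right {u v : Fin d → ℝ} (hv : v ∈ T.K) : T.Le u (u + v) :=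
  ⟨1, one_pos, by simpa using hv⟩

theorem le_add_left {u v : Fin d → ℝ} (hv : v ∈ T.K) : T.Le u (v + u) :=
  ⟨1, one_pos, by simpa using hv⟩

theorem le_of_sub {u v : Fin d → ℝ} (h : v - u ∈ T.K) : T.Le u v := ⟨1, one_pos, by simpa using h⟩

theorem Le.add {T : Cset d} {u v w : Fin d → ℝ} (hu : u ∈ T.K) (hv : v ∈ T.K) (h1 : T.Le u w) (h2 : T.Le v w) :
    T.Le (u + v) w := by
  obtain ⟨s, hs, h1⟩ := h1
  obtain ⟨t, ht, h2⟩ := h2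
  refine ⟨s * t / (s + t), by positivity, ?_⟩
  have hst : s + t ≠ 0 := by positivity
  have := T.Kadd (T.Ksmul (t := t / (s + t)) (by positivity) h1)
    (T.Ksmul (t := s / (s + t)) (by positivity) h2)
  convert this using 1
  ext i
  simp
  field_simp
  ring

theorem le_smul {u v : Fin d → ℝ} {c : ℝ} (hc : 0 < c) (h : T.Le u v) : T.Le u (c • v) := by
  obtain ⟨s, hs, h1⟩ := h
  refine ⟨c * s, by positivity, ?_⟩
  have := T.Ksmul hc.le h1
  convert this using 1
  module

theorem smul_le {u v : Fin d → ℝ} {c : ℝ} (hc : 0 < c) (h : T.Le u v) : T.Le (c • u) v := by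
  obtain ⟨s, hs, h1⟩ := h
  refine ⟨s / c, by positivity, ?_⟩
  convert h1 using 1
  rw [smul_smul, div_mul_cancel₀ _ hc.ne']

theorem Le.mono_add {T : Cset d} {u v w : Fin d → ℝ} (hu : u ∈ T.K) (hv : v ∈ T.K) (hw : w ∈ T.K)
    (h : T.Le u v) : T.Le (u + w) (v + w) :=
  Le.add hu hw (h.trans (T.le_add_right hw)) (T.le_add_left hv)

/-- anything above an interior vector is interior -/
theorem I_of_le {u v : Fin d → ℝ} (hu : u ∈ T.I) (h : T.Le u v) : v ∈ T.I := by
  obtain ⟨t, ht, h⟩ := h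
  have := T.KaddI h (T.Ismul t ht u hu)
  simpa using this

def Hyp : Prop := ∀ x ∈ T.KC, x ≠ 0 → x ∉ T.I → ∃ (G : (Fin d → ℝ) →ₗ[ℝ] ℝ) (q₁ q₂ : Fin d → ℝ) (δ : ℝ),
  0 < δ ∧ ∀ y ∈ T.KC, y ≠ 0 → T.Le y x → ¬ T.Le x y → 0 < G y ∧
    ∃ q, (q = q₁ ∨ q = q₂) ∧ q - δ • (G y)⁻¹ • y ∈ T.K ∧ (G y)⁻¹ • y - δ • q ∈ T.K

def Grp : Prop := ∃ Q : Set (Fin d → ℝ), IsCompact Q ∧ Q ⊆ T.I ∧ ∀ p ∈ T.KC, p ∈ T.I →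
  ∃ g : (Fin d → ℝ) →ₗ[ℝ] (Fin d → ℝ), (∀ v, g v ∈ T.I ↔ v ∈ T.I) ∧ (∀ v ∈ T.KC, g v ∈ T.KC) ∧ g p ∈ Q

variable {T}

theorem Hyp.two (H : T.Hyp) {x y₁ y₂ y₃ : Fin d → ℝ} (hx : x ∈ T.KC) (hx0 : x ≠ 0) (hxI : x ∉ T.I)
    (h1 : y₁ ∈ T.KC) (h10 : y₁ ≠ 0) (h1x : T.Le y₁ x) (h1x' : ¬ T.Le x y₁)
    (h2 : y₂ ∈ T.KC) (h20 : y₂ ≠ 0) (h2x : T.Le y₂ x) (h2x' : ¬ T.Le x y₂)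
    (h3 : y₃ ∈ T.KC) (h30 : y₃ ≠ 0) (h3x : T.Le y₃ x) (h3x' : ¬ T.Le x y₃) :
    (T.Le y₁ y₂ ∧ T.Le y₂ y₁) ∨ (T.Le y₁ y₃ ∧ T.Le y₃ y₁) ∨ (T.Le y₂ y₃ ∧ T.Le y₃ y₂) := by
  obtain ⟨G, q₁, q₂, δ, hδ, h⟩ := H x hx hx0 hxI
  have key : ∀ y ∈ T.KC, y ≠ 0 → T.Le y x → ¬ T.Le x y →
      ∃ q, (q = q₁ ∨ q = q₂) ∧ T.Le y q ∧ T.Le q y := by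
    intro y hy hy0 hyx hyx'
    obtain ⟨hG, q, hq, ha, hb⟩ := h y hy hy0 hyx hyx'
    refine ⟨q, hq, ⟨δ * (G y)⁻¹, by positivity, by rwa [mul_smul]⟩, ?_⟩
    have := T.le_smul hG (⟨δ, hδ, hb⟩ : T.Le q _)
    rwa [smul_inv_smul₀ hG.ne'] at this
  obtain ⟨a, ha, ha1, ha2⟩ := key _ h1 h10 h1x h1x'
  obtain ⟨b, hb, hb1, hb2⟩ := key _ h2 h20 h2x h2x'
  obtain ⟨c, hc, hc1, hc2⟩ := key _ h3 h30 h3x h3x'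
  have hab : a = b → (T.Le y₁ y₂ ∧ T.Le y₂ y₁) := by
    rintro rfl; exact ⟨ha1.trans hb2, hb1.trans ha2⟩
  have hac : a = c → (T.Le y₁ y₃ ∧ T.Le y₃ y₁) := by
    rintro rfl; exact ⟨ha1.trans hc2, hc1.trans ha2⟩
  have hbc : b = c → (T.Le y₂ y₃ ∧ T.Le y₃ y₂) := by
    rintro rfl; exact ⟨hb1.trans hc2, hc1.trans hb2⟩
  by_cases e1 : a = b
  · exact Or.inl (hab e1)
  by_cases e2 : a = c
  · exact Or.inr (Or.inl (hac e2))
  right; right; apply hbc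
  rcases ha with rfl | rfl <;> rcases hb with rfl | rfl <;> rcases hc with rfl | rfl <;> simp_all

theorem Hyp.ext (H : T.Hyp) {x y a : Fin d → ℝ} (hx : x ∈ T.KC) (hx0 : x ≠ 0) (hxI : x ∉ T.I)
    (hy : y ∈ T.KC) (hyx : T.Le y x) (hyx' : ¬ T.Le x y)
    (ha : a ∈ T.KC) (ha0 : a ≠ 0) (hay : T.Le a y) : T.Le y a := by
  obtain ⟨G, q₁, q₂, δ, hδ, h⟩ := H x hx hx0 hxI
  have hGa : 0 < G a := (h a ha ha0 (hay.trans hyx) (fun h' => hyx' (h'.trans hay))).1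
  have hGc : Continuous G := G.continuous_of_finiteDimensional
  let z : ℕ → Fin d → ℝ := fun n => a + (1 / ((n : ℝ) + 1)) • y
  have hz : Tendsto z atTop (nhds a) := by
    have : Tendsto z atTop (nhds (a + (0 : ℝ) • y)) :=
      tendsto_const_nhds.add (tendsto_one_div_add_atTop_nhds_zero_nat.smul_const y)
    simpa using this
  have hyK := T.KCsub hy
  have haK := T.KCsub ha
  have hzK : ∀ n, z n ∈ T.KC := fun n => T.KCadd _ ha _ (T.KCsmul _ (by positivity) _ hy)
  have hyz : ∀ n, T.Le y (z n) := fun n =>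
    (T.le_smul (by positivity) (T.le_refl y)).trans (T.le_add_left haK)
  have hzy : ∀ n, T.Le (z n) y := fun n =>
    Le.add haK (T.Ksmul (by positivity) hyK) hay (T.smul_le (by positivity) (T.le_refl y))
  have hz0 : ∀ n, z n ≠ 0 := by
    intro n h0
    have h1 : a = -((1 / ((n : ℝ) + 1)) • y) := eq_neg_of_add_eq_zero_left h0
    exact ha0 (T.Kneg haK (by rw [h1, neg_neg]; exact T.Ksmul (by positivity) hyK))
  have main : ∀ n, ∃ q, (q = q₁ ∨ q = q₂) ∧ T.Le y q ∧ (G (z n))⁻¹ • z n - δ • q ∈ T.K := by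
    intro n
    obtain ⟨hG, q, hq, h1, h2⟩ := h (z n) (hzK n) (hz0 n) ((hzy n).trans hyx)
      (fun h' => hyx' (h'.trans (hzy n)))
    exact ⟨q, hq, (hyz n).trans ⟨δ * (G (z n))⁻¹, by positivity, by rwa [mul_smul]⟩, h2⟩
  have hlim : ∀ q, Tendsto (fun n => (G (z n))⁻¹ • z n - δ • q) atTop (nhds ((G a)⁻¹ • a - δ • q)) := by
    intro q
    exact ((((hGc.tendsto a).comp hz).inv₀ hGa.ne').smul hz).sub tendsto_const_nhds
  have fin : ∀ q, (∃ᶠ n in atTop, T.Le y q ∧ (G (z n))⁻¹ • z n - δ • q ∈ T.K) → T.Le y a := by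
    intro q hq
    obtain ⟨n, hn, -⟩ := hq.exists
    have h1 : (G a)⁻¹ • a - δ • q ∈ T.K :=
      T.Kcl.mem_of_frequently_of_tendsto (hq.mono fun n h => h.2) (hlim q)
    have := T.le_smul hGa (⟨δ, hδ, h1⟩ : T.Le q _)
    rw [smul_inv_smul₀ hGa.ne'] at this
    exact hn.trans this
  have hf : ∃ᶠ n in atTop, (T.Le y q₁ ∧ (G (z n))⁻¹ • z n - δ • q₁ ∈ T.K) ∨
      (T.Le y q₂ ∧ (G (z n))⁻¹ • z n - δ • q₂ ∈ T.K) := by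
    apply Eventually.frequently
    refine Eventually.of_forall fun n => ?_
    obtain ⟨q, rfl | rfl, h1⟩ := main n
    · exact Or.inl h1
    · exact Or.inr h1
  rcases frequently_or_distrib.1 hf with h | h
  · exact fin _ h
  · exact fin _ h

end Cset

end

section

namespace Cset
variable {T : Cset d}

theorem triad (H : T.Hyp) {w a b c : Fin d → ℝ} (hw : w ∈ T.KC) (ha : a ∈ T.KC) (hb : b ∈ T.KC)
    (hc : c ∈ T.KC) (hab : w + a + b ∈ T.I) (hac : w + a + c ∈ T.I) (hbc : w + b + c ∈ T.I)
    (ha' : w + a ∉ T.I) (hb' : w + b ∉ T.I) (hc' : w + c ∉ T.I) (habc : a + b + c ∉ T.I) : False := by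
  have hwK := T.KCsub hw
  have haK := T.KCsub ha
  have hbK := T.KCsub hb
  have hcK := T.KCsub hc
  -- if y ≼ x then w + x is interior as soon as w + x + y is
  have key : ∀ x ∈ T.K, ∀ y ∈ T.K, w + x + y ∈ T.I → w + x ∉ T.I → ¬ T.Le y x := by
    intro x hx y hy h1 h2 h3
    apply h2
    exact T.I_of_le h1 (Le.add (T.Kadd hwK hx) hy (T.le_refl _) (h3.trans (T.le_add_left hwK)))
  have hxC : a + b + c ∈ T.KC := T.KCadd _ (T.KCadd _ ha _ hb) _ hc
  have ne : ∀ x ∈ T.K, ∀ y ∈ T.K, w + x + y ∈ T.I → w + x ∉ T.I → y ≠ 0 := by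
    rintro x hx y hy h1 h2 rfl
    exact h2 (by simpa using h1)
  have hba : w + b + a ∈ T.I := by rwa [add_right_comm]
  have hca : w + c + a ∈ T.I := by rwa [add_right_comm]
  have hcb : w + c + b ∈ T.I := by rwa [add_right_comm]
  have a0 := ne b hbK a haK hba hb'
  have b0 := ne a haK b hbK hab ha'
  have c0 := ne a haK c hcK hac ha'
  have lea : T.Le a (a + b + c) := (T.le_add_right hbK).trans (T.le_add_right hcK)
  have leb : T.Le b (a + b + c) := (T.le_add_left haK).trans (T.le_add_right hcK)
  have lec : T.Le c (a + b + c) := T.le_add_left (T.Kadd haK hbK)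
  have x0 : a + b + c ≠ 0 := by
    intro h0
    have h1 : c = -(a + b) := by rw [eq_neg_iff_add_eq_zero, add_comm]; exact h0
    exact c0 (T.Kneg hcK (by rw [h1, neg_neg]; exact T.Kadd haK hbK))
  have k1 := key a haK b hbK hab ha'
  have k2 := key b hbK a haK hba hb'
  have k3 := key c hcK a haK hca hc'
  have k4 := key c hcK b hbK hcb hc'
  rcases H.two hxC x0 habc ha a0 lea (fun h => k1 (leb.trans h)) hb b0 leb
    (fun h => k2 (lea.trans h)) hc c0 lec (fun h => k3 (lea.trans h)) with h | h | h
  · exact k1 h.2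
  · exact k3 h.1
  · exact k4 h.1

theorem zoom (Gr : T.Grp) {w a b c : Fin d → ℝ} (hw : w ∈ T.KC) (ha : a ∈ T.KC) (hb : b ∈ T.KC)
    (hc : c ∈ T.KC) (hw0 : w ≠ 0) (hab : w + a + b ∈ T.I) (hac : w + a + c ∈ T.I) (hbc : w + b + c ∈ T.I)
    (ha' : w + a ∉ T.I) (hb' : w + b ∉ T.I) (hc' : w + c ∉ T.I) :
    ∃ w' ∈ T.KC, ∃ a' ∈ T.KC, ∃ b' ∈ T.KC, ∃ c' ∈ T.KC, w' + a' + b' ∈ T.I ∧ w' + a' + c' ∈ T.I ∧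
      w' + b' + c' ∈ T.I ∧ w' + a' ∉ T.I ∧ w' + b' ∉ T.I ∧ w' + c' ∉ T.I ∧ a' + b' + c' ∉ T.I := by
  have hwK := T.KCsub hw
  have haK := T.KCsub ha
  have hbK := T.KCsub hb
  have hcK := T.KCsub hc
  obtain ⟨Q, hQ, hQI, hg⟩ := Gr
  let ε : ℕ → ℝ := fun n => 1 / ((n : ℝ) + 1)
  have hε : ∀ n, 0 < ε n := fun n => by positivity
  have hε1 : ∀ n, ε n ≤ 1 := fun n => by
    simp only [ε]; rw [div_le_one (by positivity)]; linarith [(Nat.cast_nonneg n : (0:ℝ) ≤ n)]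
  have hεl : Tendsto ε atTop (nhds 0) := tendsto_one_div_add_atTop_nhds_zero_nat
  -- conical scaling
  have scal : ∀ n u, w + u ∈ T.I → w + ε n • u ∈ T.I := by
    intro n u hu
    have := T.IaddK (T.Ismul _ (hε n) _ hu) (T.Ksmul (sub_nonneg.2 (hε1 n)) hwK)
    convert this using 1
    module
  have scal' : ∀ n, ∀ u ∈ T.K, w + u ∉ T.I → w + ε n • u ∉ T.I := by
    intro n u hu h1 h2
    apply h1
    have := T.IaddK h2 (T.Ksmul (sub_nonneg.2 (hε1 n)) hu)
    convert this using 1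
    module
  obtain ⟨tc, htc, hc1⟩ := T.Isub hab c
  obtain ⟨tb, htb, hb1⟩ := T.Isub hac b
  obtain ⟨ta, hta, ha1⟩ := T.Isub hbc a
  have hp : ∀ n, ∃ g : (Fin d → ℝ) →ₗ[ℝ] (Fin d → ℝ), (∀ v, g v ∈ T.I ↔ v ∈ T.I) ∧
      (∀ v ∈ T.KC, g v ∈ T.KC) ∧ g (w + ε n • (a + b)) ∈ Q := by
    intro n
    exact hg _ (T.KCadd _ hw _ (T.KCsmul _ (hε n).le _ (T.KCadd _ ha _ hb)))
      (scal n _ (by rwa [← add_assoc]))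
  choose g gI gC gQ using hp
  have gK : ∀ n, ∀ v ∈ T.K, g n v ∈ T.K := fun n v hv =>
    map_mem_closure (g n).continuous_of_finiteDimensional hv (fun u hu => (gI n u).2 hu)
  -- boundedness
  obtain ⟨m, hm⟩ := (hQ.image T.fcont).bddAbove
  have hm' : ∀ n, T.f (g n w) + ε n * T.f (g n a) + ε n * T.f (g n b) ≤ m := by
    intro n
    have := hm (mem_image_of_mem _ (gQ n))
    simp only [map_add, map_smul, smul_eq_mul] at this
    linarith
  have fw : ∀ n, 0 ≤ T.f (g n w) := fun n => T.Kf (gK n _ hwK)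
  have fa : ∀ n, 0 ≤ ε n * T.f (g n a) := fun n => mul_nonneg (hε n).le (T.Kf (gK n _ haK))
  have fb : ∀ n, 0 ≤ ε n * T.f (g n b) := fun n => mul_nonneg (hε n).le (T.Kf (gK n _ hbK))
  have fc : ∀ n, tc * (ε n * T.f (g n c)) ≤ m := by
    intro n
    have h1 : w + ε n • (a + b - tc • c) ∈ T.I := scal n _ (by
      convert hc1 using 1; module)
    have := T.Kf (gK n _ (T.IK h1))
    simp only [map_add, map_smul, smul_eq_mul, map_sub] at this
    linarith [hm' n]
  have bd : ∀ m' : ℝ, ∀ u ∈ T.K, T.f u ≤ m' → u ∈ Metric.closedBall (0 : Fin d → ℝ) (|T.M| * |m'|) := by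
    intro m' u hu h
    rw [mem_closedBall_zero_iff]
    calc ‖u‖ ≤ T.M * T.f u := T.Kbd hu
      _ ≤ |T.M| * T.f u := mul_le_mul_of_nonneg_right (le_abs_self _) (T.Kf hu)
      _ ≤ |T.M| * |m'| := mul_le_mul_of_nonneg_left (h.trans (le_abs_self _)) (abs_nonneg _)
  let s : ℕ → (Fin d → ℝ) × (Fin d → ℝ) × (Fin d → ℝ) × (Fin d → ℝ) :=
    fun n => (g n w, ε n • g n a, ε n • g n b, ε n • g n c)
  have hcpt : IsCompact (Metric.closedBall (0 : Fin d → ℝ) (|T.M| * |m|) ×ˢ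
      Metric.closedBall (0 : Fin d → ℝ) (|T.M| * |m|) ×ˢ
      Metric.closedBall (0 : Fin d → ℝ) (|T.M| * |m|) ×ˢ
      Metric.closedBall (0 : Fin d → ℝ) (|T.M| * |m / tc|)) :=
    (isCompact_closedBall _ _).prod ((isCompact_closedBall _ _).prod
      ((isCompact_closedBall _ _).prod (isCompact_closedBall _ _)))
  obtain ⟨⟨W, A, B, C⟩, -, φ, hφ, hl⟩ := hcpt.tendsto_subseq (x := s) (by
    intro n
    have eK : ∀ u ∈ T.K, ε n • g n u ∈ T.K := fun u hu => T.Ksmul (hε n).le (gK n u hu)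
    refine ⟨bd _ _ (gK n _ hwK) ?_, bd _ _ (eK _ haK) ?_, bd _ _ (eK _ hbK) ?_, bd _ _ (eK _ hcK) ?_⟩
    · linarith [hm' n, fa n, fb n]
    · rw [map_smul, smul_eq_mul]; linarith [hm' n, fw n, fb n]
    · rw [map_smul, smul_eq_mul]; linarith [hm' n, fa n, fw n]
    · rw [map_smul, smul_eq_mul, le_div_iff₀ htc]; linarith [fc n])
  have lW : Tendsto (fun n => g (φ n) w) atTop (nhds W) := (continuous_fst.tendsto _).comp hl
  have hl2 := (continuous_snd.tendsto _).comp hl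
  have lA : Tendsto (fun n => ε (φ n) • g (φ n) a) atTop (nhds A) := (continuous_fst.tendsto _).comp hl2
  have hl3 := (continuous_snd.tendsto _).comp hl2
  have lB : Tendsto (fun n => ε (φ n) • g (φ n) b) atTop (nhds B) := (continuous_fst.tendsto _).comp hl3
  have lC : Tendsto (fun n => ε (φ n) • g (φ n) c) atTop (nhds C) := (continuous_snd.tendsto _).comp hl3
  have WC : W ∈ T.KC := T.KCclosed.mem_of_tendsto lW (Eventually.of_forall fun n => gC _ _ hw)
  have AC : A ∈ T.KC := T.KCclosed.mem_of_tendsto lA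
    (Eventually.of_forall fun n => T.KCsmul _ (hε _).le _ (gC _ _ ha))
  have BC : B ∈ T.KC := T.KCclosed.mem_of_tendsto lB
    (Eventually.of_forall fun n => T.KCsmul _ (hε _).le _ (gC _ _ hb))
  have CC : C ∈ T.KC := T.KCclosed.mem_of_tendsto lC
    (Eventually.of_forall fun n => T.KCsmul _ (hε _).le _ (gC _ _ hc))
  have AB : W + A + B ∈ T.I := by
    apply hQI
    refine hQ.isClosed.mem_of_tendsto ((lW.add lA).add lB) (Eventually.of_forall fun n => ?_)
    have := gQ (φ n)
    simp only [map_add, map_smul, smul_add, ← add_assoc] at this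
    exact this
  have notI : ∀ u ∈ T.K, w + u ∉ T.I → ∀ U, Tendsto (fun n => ε (φ n) • g (φ n) u) atTop (nhds U) →
      W + U ∉ T.I := by
    intro u hu hwu U hU hI
    obtain ⟨n, hn⟩ := ((lW.add hU).eventually (T.Iopen.mem_nhds hI)).exists
    refine scal' (φ n) u hu hwu ((gI (φ n) _).1 ?_)
    rw [map_add, map_smul]; exact hn
  have subK : ∀ (u v : Fin d → ℝ) (t : ℝ), 0 < t → w + u - t • v ∈ T.I →
      ∀ U, Tendsto (fun n => ε (φ n) • g (φ n) u) atTop (nhds U) →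
      ∀ V, Tendsto (fun n => ε (φ n) • g (φ n) v) atTop (nhds V) → W + U - t • V ∈ T.K := by
    intro u v t ht huv U hU V hV
    refine T.Kcl.mem_of_tendsto ((lW.add hU).sub (hV.const_smul t)) (Eventually.of_forall fun n => ?_)
    have h1 : w + ε (φ n) • (u - t • v) ∈ T.I := scal _ _ (by rwa [← add_sub_assoc])
    have := gK (φ n) _ (T.IK h1)
    simp only [map_add, map_smul, map_sub, smul_sub] at this
    rw [smul_comm t, add_sub_assoc]
    exact this
  have lAC : Tendsto (fun n => ε (φ n) • g (φ n) (a + c)) atTop (nhds (A + C)) := by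
    simpa only [map_add, smul_add] using lA.add lC
  have lBC : Tendsto (fun n => ε (φ n) • g (φ n) (b + c)) atTop (nhds (B + C)) := by
    simpa only [map_add, smul_add] using lB.add lC
  have upg : ∀ (U V : Fin d → ℝ) (t : ℝ), 0 < t → U ∈ T.K → V ∈ T.K → W + U + V ∈ T.I → W + (U + C) - t • V ∈ T.K → W + U + C ∈ T.I := by
    intro U V t ht hU hV h1 h2
    have h3 := T.KaddI h2 (T.Ismul t ht _ h1)
    refine T.I_of_le h3 ⟨(1 + t)⁻¹, by positivity, ?_⟩
    convert T.Ksmul (t := t / (1 + t)) (by positivity) (T.KCsub CC) using 1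
    have : 1 + t ≠ 0 := by positivity
    ext i
    simp
    field_simp
    ring
  refine ⟨W, WC, A, AC, B, BC, C, CC, AB, ?_, ?_, notI a haK ha' A lA, notI b hbK hb' B lB,
    notI c hcK hc' C lC, ?_⟩
  · exact upg A B tb htb (T.KCsub AC) (T.KCsub BC) AB
      (subK (a + c) b tb htb (by rwa [← add_assoc]) _ lAC _ lB)
  · exact upg B A ta hta (T.KCsub BC) (T.KCsub AC) (by rwa [add_right_comm])
      (subK (b + c) a ta hta (by rwa [← add_assoc]) _ lBC _ lA)
  · intro hI
    obtain ⟨t, ht, h1⟩ := T.Isub hI W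
    have h2 := ((((lA.add lB).add lC).sub (lW.const_smul t)).eventually (T.Iopen.mem_nhds h1))
    have h3 : ∀ᶠ n in atTop, ε (φ n) • (a + b + c) - t • w ∈ T.K := by
      filter_upwards [h2] with n hn
      apply T.IK
      refine (gI (φ n) _).1 ?_
      simp only [map_add, map_smul, map_sub, smul_add]; exact hn
    have h4 : Tendsto (fun n => ε (φ n) • (a + b + c) - t • w) atTop
        (nhds ((0 : ℝ) • (a + b + c) - t • w)) :=
      ((hεl.comp hφ.tendsto_atTop).smul_const _).sub tendsto_const_nhds
    have h5 := T.Kcl.mem_of_tendsto h4 h3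
    rw [zero_smul, zero_sub] at h5
    have h6 := T.Kneg (T.Ksmul ht.le hwK) h5
    exact hw0 ((smul_eq_zero.1 h6).resolve_left ht.ne')

/-- equivalence (same open face) -/
def Eqv (T : Cset d) (u v : Fin d → ℝ) : Prop := T.Le u v ∧ T.Le v u

theorem Eqv.trans {u v w : Fin d → ℝ} (h1 : T.Eqv u v) (h2 : T.Eqv v w) : T.Eqv u w :=
  ⟨h1.1.trans h2.1, h2.2.trans h1.2⟩

theorem Eqv.symm {u v : Fin d → ℝ} (h1 : T.Eqv u v) : T.Eqv v u := ⟨h1.2, h1.1⟩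

/-- `z` is equivalent to one of the vertices or edges of the triangle -/
def InS (T : Cset d) (e : Fin 3 → Fin d → ℝ) (z : Fin d → ℝ) : Prop :=
  (∃ i, T.Eqv z (e i)) ∨ ∃ i j, i ≠ j ∧ T.Eqv z (e i + e j)

theorem InS.of_eqv {e : Fin 3 → Fin d → ℝ} {y z : Fin d → ℝ} (h : T.Eqv z y) (hy : T.InS e y) :
    T.InS e z := by
  rcases hy with ⟨i, hi⟩ | ⟨i, j, hij, hi⟩
  · exact Or.inl ⟨i, h.trans hi⟩
  · exact Or.inr ⟨i, j, hij, h.trans hi⟩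

structure Tri (T : Cset d) (e : Fin 3 → Fin d → ℝ) : Prop where
  mem : ∀ i, e i ∈ T.KC
  ne : ∀ i, e i ≠ 0
  int : ∀ i j k, i ≠ j → i ≠ k → j ≠ k → e i + e j + e k ∈ T.I
  bd : ∀ i j, e i + e j ∉ T.I

theorem exists_third (i j : Fin 3) : ∃ k, i ≠ k ∧ j ≠ k := by
  revert i j; decide

theorem exists_next : ∀ i : Fin 3, i ≠ i + 1 := by decide

theorem exists_two : ∀ i : Fin 3, ∃ j k, i ≠ j ∧ i ≠ k ∧ j ≠ k := by decide

theorem Tri.vert {e : Fin 3 → Fin d → ℝ} (h : T.Tri e) {i j : Fin 3} (hij : i ≠ j) : ¬ T.Le (e j) (e i) := by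
  intro hle
  obtain ⟨k, hik, hjk⟩ := exists_third i j
  have hK := fun i => T.KCsub (h.mem i)
  refine h.bd i k (T.I_of_le (h.int i k j hik hij hjk.symm) ?_)
  exact Le.add (T.Kadd (hK i) (hK k)) (hK j) (T.le_refl _) (hle.trans (T.le_add_right (hK k)))

theorem Kne {u v : Fin d → ℝ} (hu : u ∈ T.K) (hv : v ∈ T.K) (hu0 : u ≠ 0) : u + v ≠ 0 := by
  intro h0
  have h1 : u = -v := eq_neg_of_add_eq_zero_left h0
  exact hu0 (T.Kneg hu (by rw [h1, neg_neg]; exact hv))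

theorem step1 (H : T.Hyp) {e : Fin 3 → Fin d → ℝ} (h : T.Tri e) {A B : Fin d → ℝ} (hA : A ∈ T.KC)
    (hB : B ∈ T.KC) (hA0 : A ≠ 0) (hAB : T.InS e (A + B)) : T.InS e A := by
  have hK := fun i => T.KCsub (h.mem i)
  have hAK := T.KCsub hA
  have hBK := T.KCsub hB
  have leA : T.Le A (A + B) := T.le_add_right hBK
  rcases hAB with ⟨i, hi⟩ | ⟨i, j, hij, hi⟩
  · obtain ⟨j, hij⟩ : ∃ j, i ≠ j := ⟨_, exists_next i⟩
    left
    refine ⟨i, leA.trans hi.1, ?_⟩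
    exact H.ext (x := e i + e j) (T.KCadd _ (h.mem i) _ (h.mem j)) (Kne (hK i) (hK j) (h.ne i))
      (h.bd i j) (h.mem i) (T.le_add_right (hK j))
      (fun h' => h.vert hij ((T.le_add_left (hK i)).trans h')) hA hA0 (leA.trans hi.1)
  · by_cases hx : T.Le (e i + e j) A
    · exact Or.inr ⟨i, j, hij, leA.trans hi.1, hx⟩
    · rcases H.two (x := e i + e j) (T.KCadd _ (h.mem i) _ (h.mem j)) (Kne (hK i) (hK j) (h.ne i))
        (h.bd i j) hA hA0 (leA.trans hi.1) hx (h.mem i) (h.ne i) (T.le_add_right (hK j))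
        (fun h' => h.vert hij ((T.le_add_left (hK i)).trans h'))
        (h.mem j) (h.ne j) (T.le_add_left (hK i))
        (fun h' => h.vert hij.symm ((T.le_add_right (hK j)).trans h')) with h1 | h1 | h1
      · exact Or.inl ⟨i, h1⟩
      · exact Or.inl ⟨j, h1⟩
      · exact absurd h1.1 (h.vert hij.symm)

theorem step2 (H : T.Hyp) (Gr : T.Grp) {e : Fin 3 → Fin d → ℝ} (h : T.Tri e) {A B : Fin d → ℝ} (hA : A ∈ T.KC)
    (hB : B ∈ T.KC) (hA0 : A ≠ 0) (hABI : A + B ∉ T.I) (hAS : T.InS e A) : T.InS e (A + B) := by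
  have hK := fun i => T.KCsub (h.mem i)
  have hAK := T.KCsub hA
  have hBK := T.KCsub hB
  have leA : T.Le A (A + B) := T.le_add_right hBK
  by_cases hle : T.Le (A + B) A
  · exact InS.of_eqv ⟨hle, leA⟩ hAS
  rcases hAS with ⟨i, hi⟩ | ⟨i, j, hij, hi⟩
  · have eqv : T.Eqv (A + B) (e i + B) :=
      ⟨Le.mono_add hAK (hK i) hBK hi.1, Le.mono_add (hK i) hAK hBK hi.2⟩
    have hx' : ¬ T.Le (e i + B) (e i) := fun h' => hle (eqv.1.trans (h'.trans hi.2))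
    have xI : e i + B ∉ T.I := fun h' => hABI (T.I_of_le h' eqv.2)
    have key : ∀ j, i ≠ j → T.InS e (A + B) ∨ e i + e j + B ∈ T.I := by
      intro j hij
      by_contra! hcon
      obtain ⟨hc1, hc2⟩ := hcon
      have xC : e i + e j + B ∈ T.KC := T.KCadd _ (T.KCadd _ (h.mem i) _ (h.mem j)) _ hB
      have x0 : e i + e j + B ≠ 0 := Kne (T.Kadd (hK i) (hK j)) hBK (Kne (hK i) (hK j) (h.ne i))
      have r1 : T.Le (e i + e j + B) (e i + e j) := by
        by_contra hn
        have := H.ext xC x0 hc2 (T.KCadd _ (h.mem i) _ (h.mem j)) (T.le_add_right hBK) hn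
          (h.mem i) (h.ne i) (T.le_add_right (hK j))
        exact h.vert hij ((T.le_add_left (hK i)).trans this)
      have r0 : T.Le (e i + B) (e i + e j + B) := by
        rw [add_right_comm]; exact T.le_add_right (hK j)
      have r2 : T.Le (e i + e j + B) (e i + B) := by
        by_contra hn
        exact hx' (H.ext xC x0 hc2 (T.KCadd _ (h.mem i) _ hB) r0 hn
          (h.mem i) (h.ne i) (T.le_add_right hBK))
      exact hc1 (Or.inr ⟨i, j, hij, eqv.trans ⟨r0.trans r1, (T.le_add_right hBK).trans r2⟩⟩)
    obtain ⟨j, k, hij, hik, hjk⟩ : ∃ j k, i ≠ j ∧ i ≠ k ∧ j ≠ k :=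
      exists_two i
    rcases key j hij with r | r
    · exact r
    rcases key k hik with r' | r'
    · exact r'
    exfalso
    obtain ⟨w, hw, a, ha, b, hb, c, hc, h1, h2, h3, h4, h5, h6, h7⟩ :=
      zoom Gr (h.mem i) (h.mem j) (h.mem k) hB (h.ne i) (h.int i j k hij hik hjk) r r'
        (h.bd i j) (h.bd i k) xI
    exact triad H hw ha hb hc h1 h2 h3 h4 h5 h6 h7
  · exfalso
    have := H.ext (T.KCadd _ hA _ hB) (Kne hAK hBK hA0) hABI (T.KCadd _ (h.mem i) _ (h.mem j))
      (hi.2.trans leA) (fun h' => hle (h'.trans hi.2)) (h.mem i) (h.ne i) (T.le_add_right (hK j))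
    exact h.vert hij ((T.le_add_left (hK i)).trans this)

end Cset

end

section


def pim (v : {v : Fin d → ℝ // v ≠ 0}) : PSpace d := Projectivization.mk ℝ v.1 v.2

theorem pim_oq : IsOpenQuotientMap (pim (d := d)) := by
  have hq : Topology.IsQuotientMap (pim (d := d)) := isQuotientMap_quotient_mk'
  refine ⟨hq.surjective, hq.continuous, ?_⟩
  intro U hU
  rw [← hq.isOpen_preimage]
  have : pim ⁻¹' (pim '' U) = ⋃ c : ℝˣ, (fun v : {v : Fin d → ℝ // v ≠ 0} =>
      (⟨c • v.1, by simpa [Units.smul_def] using v.2⟩ : {v : Fin d → ℝ // v ≠ 0})) ⁻¹' U := by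
    ext v
    simp only [mem_preimage, mem_image, mem_iUnion]
    constructor
    · rintro ⟨w, hw, hwv⟩
      obtain ⟨c, hc⟩ := (Projectivization.mk_eq_mk_iff ℝ _ _ w.2 v.2).1 hwv
      exact ⟨c, by convert hw using 1; exact Subtype.ext hc⟩
    · rintro ⟨c, hc⟩
      exact ⟨_, hc, (Projectivization.mk_eq_mk_iff ℝ _ _ _ _).2 ⟨c, rfl⟩⟩
  rw [this]
  refine isOpen_iUnion fun c => hU.preimage ?_
  exact Continuous.subtype_mk (continuous_subtype_val.const_smul _) _

variable (f : (Fin d → ℝ) →ₗ[ℝ] ℝ)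

theorem rep_mk (v : Fin d → ℝ) (hv : v ≠ 0) :
    ∃ c : ℝ, c ≠ 0 ∧ (Projectivization.mk ℝ v hv).rep = c • v := by
  obtain ⟨a, ha⟩ := Projectivization.exists_smul_eq_mk_rep ℝ v hv
  exact ⟨a, a.ne_zero, ha.symm⟩

theorem chart_mk (v : Fin d → ℝ) (hv : v ≠ 0) :
    chartMap f (Projectivization.mk ℝ v hv) = (f v)⁻¹ • v := by
  obtain ⟨c, hc, h⟩ := rep_mk v hv
  rw [chartMap, h, map_smul, smul_smul, smul_eq_mul, mul_inv, mul_comm c⁻¹, mul_assoc,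
    inv_mul_cancel₀ hc, mul_one]

theorem frep_mk (v : Fin d → ℝ) (hv : v ≠ 0) :
    f (Projectivization.mk ℝ v hv).rep ≠ 0 ↔ f v ≠ 0 := by
  obtain ⟨c, hc, h⟩ := rep_mk v hv
  rw [h, map_smul, smul_eq_mul, mul_ne_zero_iff]
  exact ⟨fun h => h.2, fun h => ⟨hc, h⟩⟩

theorem chart_cont (v : Fin d → ℝ) (hv : v ≠ 0) (hf : f v ≠ 0) :
    ContinuousAt (chartMap f) (Projectivization.mk ℝ v hv) := by
  have : ContinuousAt (chartMap f ∘ pim) (⟨v, hv⟩ : {v : Fin d → ℝ // v ≠ 0}) := by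
    have e : chartMap f ∘ pim = fun v : {v : Fin d → ℝ // v ≠ 0} => (f v.1)⁻¹ • v.1 := by
      ext1 v; exact chart_mk f v.1 v.2
    rw [e]
    have hc : Continuous f := f.continuous_of_finiteDimensional
    have h1 : ContinuousAt (fun v : {v : Fin d → ℝ // v ≠ 0} => f v.1) ⟨v, hv⟩ :=
      (hc.comp continuous_subtype_val).continuousAt
    exact (h1.inv₀ hf).smul continuous_subtype_val.continuousAt
  exact pim_oq.continuousAt_comp_iff.1 this

theorem mk_smul_eq (v : Fin d → ℝ) (hv : v ≠ 0) (c : ℝ) (h : c • v ≠ 0) :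
    Projectivization.mk ℝ (c • v) h = Projectivization.mk ℝ v hv :=
  (Projectivization.mk_eq_mk_iff' ℝ _ _ _ _).2 ⟨c, rfl⟩

theorem eq_mk_of_chart {z : PSpace d} {v : Fin d → ℝ} (hv : v ≠ 0) {c : ℝ} (hc : c ≠ 0)
    (h : chartMap f z = c • v) : z = Projectivization.mk ℝ v hv := by
  have hz : f z.rep ≠ 0 := by
    intro h0
    rw [chartMap, h0, inv_zero, zero_smul] at h
    exact smul_ne_zero hc hv h.symm
  conv_lhs => rw [← z.mk_rep]
  rw [Projectivization.mk_eq_mk_iff']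
  refine ⟨f z.rep * c, ?_⟩
  rw [mul_smul, ← h, chartMap, smul_inv_smul₀ hz]

/-- positive cone over A -/
def coneOf (A : Set (PSpace d)) : Set (Fin d → ℝ) :=
  {v | 0 < f v ∧ ∃ h, Projectivization.mk ℝ v h ∈ A}

theorem fne {v : Fin d → ℝ} (h : f v ≠ 0) : v ≠ 0 := by rintro rfl; simp at h

theorem mem_cone_iff {A : Set (PSpace d)} {v : Fin d → ℝ} (hf : 0 < f v) :
    v ∈ coneOf f A ↔ (f v)⁻¹ • v ∈ chartMap f '' A := by
  constructor
  · rintro ⟨-, h, hA⟩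
    exact ⟨_, hA, chart_mk f v h⟩
  · rintro ⟨z, hz, h⟩
    have hv := fne f hf.ne'
    exact ⟨hf, hv, by rwa [← eq_mk_of_chart f hv (inv_ne_zero hf.ne') h]⟩

theorem cone_smul {A : Set (PSpace d)} {v : Fin d → ℝ} {t : ℝ} (ht : 0 < t) (h : v ∈ coneOf f A) :
    t • v ∈ coneOf f A := by
  obtain ⟨h1, h2, h3⟩ := h
  refine ⟨by rw [map_smul]; exact mul_pos ht h1, smul_ne_zero ht.ne' h2, ?_⟩
  rwa [mk_smul_eq v h2 t]

theorem cone_add {A : Set (PSpace d)} (hA : Convex ℝ (chartMap f '' A)) {u v : Fin d → ℝ}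
    (hu : u ∈ coneOf f A) (hv : v ∈ coneOf f A) : u + v ∈ coneOf f A := by
  have h1 := hu.1
  have h2 := hv.1
  have h3 : 0 < f (u + v) := by rw [map_add]; linarith
  rw [mem_cone_iff f h1] at hu
  rw [mem_cone_iff f h2] at hv
  rw [mem_cone_iff f h3]
  have := hA hu hv (a := f u / f (u + v)) (b := f v / f (u + v)) (by positivity) (by positivity)
    (by rw [← add_div, ← map_add, div_self h3.ne'])
  convert this using 1
  rw [smul_smul, smul_smul, div_mul_eq_mul_div, mul_inv_cancel₀ h1.ne', div_mul_eq_mul_div,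
    mul_inv_cancel₀ h2.ne', one_div, smul_add]

theorem cone_open {A : Set (PSpace d)} (hA : IsOpen A) : IsOpen (coneOf f A) := by
  have h1 : IsOpen (Subtype.val '' ((pim (d := d)) ⁻¹' A)) :=
    (IsOpen.isOpenMap_subtype_val isOpen_ne) _ (hA.preimage pim_oq.continuous)
  have h2 : IsOpen {v | 0 < f v} := isOpen_lt continuous_const f.continuous_of_finiteDimensional
  convert h2.inter h1 using 1
  ext v
  constructor
  · rintro ⟨h, h', h''⟩; exact ⟨h, ⟨v, h'⟩, h'', rfl⟩
  · rintro ⟨h, ⟨w, h'⟩, h'', rfl⟩; exact ⟨h, h', h''⟩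

theorem mem_closure_mk {A : Set (PSpace d)} (hA : ∀ x ∈ A, f x.rep ≠ 0) {v : Fin d → ℝ} (hv : v ≠ 0) :
    Projectivization.mk ℝ v hv ∈ closure A ↔
      v ∈ closure (coneOf f A) ∨ -v ∈ closure (coneOf f A) := by
  have h1 : Projectivization.mk ℝ v hv ∈ closure A ↔
      (⟨v, hv⟩ : {v : Fin d → ℝ // v ≠ 0}) ∈ closure (pim ⁻¹' A) := by
    rw [← pim_oq.isOpenMap.preimage_closure_eq_closure_preimage pim_oq.continuous]; rfl
  have h2 : Subtype.val '' ((pim (d := d)) ⁻¹' A) = coneOf f A ∪ -(coneOf f A) := by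
    ext w
    constructor
    · rintro ⟨⟨w, hw⟩, h, rfl⟩
      have h3 : f w ≠ 0 := (frep_mk f w hw).1 (hA _ h)
      rcases h3.lt_or_gt with h4 | h4
      · right
        have hw' : -w ≠ 0 := neg_ne_zero.2 hw
        refine ⟨by rw [map_neg]; linarith, hw', ?_⟩
        have : Projectivization.mk ℝ (-w) hw' = Projectivization.mk ℝ w hw :=
          (Projectivization.mk_eq_mk_iff' ℝ _ _ _ _).2 ⟨-1, by simp⟩
        rw [this]; exact h
      · exact Or.inl ⟨h4, hw, h⟩
    · rintro (⟨h3, hw, h⟩ | ⟨h3, hw, h⟩)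
      · exact ⟨⟨w, hw⟩, h, rfl⟩
      · have hw' : w ≠ 0 := neg_ne_zero.1 hw
        refine ⟨⟨w, hw'⟩, ?_, rfl⟩
        have : Projectivization.mk ℝ (-w) hw = Projectivization.mk ℝ w hw' :=
          (Projectivization.mk_eq_mk_iff' ℝ _ _ _ _).2 ⟨-1, by simp⟩
        rw [this] at h; exact h
  rw [h1, closure_subtype, h2, closure_union, ← neg_closure]
  rfl

end

section


theorem chartOf_spec {A : Set (PSpace d)} (h : IsProperlyConvex A) :
    (∀ x ∈ closure A, chartOf A x.rep ≠ 0) ∧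
    Convex ℝ (chartMap (chartOf A) '' A) ∧ Bornology.IsBounded (chartMap (chartOf A) '' A) := by
  have : chartOf A = h.choose := by rw [chartOf, dif_pos h]
  rw [this]
  exact h.choose_spec

def toC (T : NCCTriple d) : Cset d where
  I := coneOf (chartOf T.Ω) T.Ω
  KC := closure (coneOf (chartOf T.Ω) T.C)
  f := chartOf T.Ω
  M := (chartOf_spec T.properlyConvex_Ω).2.2.exists_norm_le.choose
  Iopen := cone_open _ T.isOpen_Ω
  Ine := by
    obtain ⟨x, hx⟩ := T.nonempty_Ω
    have h1 := (chartOf_spec T.properlyConvex_Ω).1 x (subset_closure hx)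
    have h2 : chartOf T.Ω (chartMap (chartOf T.Ω) x) = 1 := by
      rw [chartMap, map_smul, smul_eq_mul, inv_mul_cancel₀ h1]
    refine ⟨chartMap (chartOf T.Ω) x, ?_⟩
    rw [mem_cone_iff _ (by rw [h2]; exact one_pos), h2, inv_one, one_smul]
    exact mem_image_of_mem _ hx
  Iadd := fun u hu v hv => cone_add _ (chartOf_spec T.properlyConvex_Ω).2.1 hu hv
  Ismul := fun t ht u hu => cone_smul _ ht hu
  fpos := fun u hu => hu.1
  fbd := by
    intro u hu
    have h1 := hu.1
    rw [mem_cone_iff _ hu.1] at hu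
    have := (chartOf_spec T.properlyConvex_Ω).2.2.exists_norm_le.choose_spec _ hu
    rw [norm_smul, norm_inv, Real.norm_of_nonneg h1.le, inv_mul_le_iff₀ h1] at this
    linarith
  KCclosed := isClosed_closure
  KCadd := fun u hu v hv => map_mem_closure₂ continuous_add hu hv
    (fun a ha b hb => cone_add _ T.C_convex ha hb)
  KCsmul := by
    intro t ht u hu
    rcases ht.eq_or_lt with h | h
    · rw [← h, zero_smul]
      have hl : Tendsto (fun n : ℕ => (1 / ((n : ℝ) + 1)) • u) atTop (nhds ((0 : ℝ) • u)) :=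
        tendsto_one_div_add_atTop_nhds_zero_nat.smul_const u
      rw [zero_smul] at hl
      exact isClosed_closure.mem_of_tendsto hl (Eventually.of_forall fun n =>
        map_mem_closure (continuous_const_smul _) hu (fun v hv => cone_smul _ (by positivity) hv))
    · exact map_mem_closure (continuous_const_smul t) hu (fun v hv => cone_smul _ h hv)
  KCsub := closure_mono fun v hv => ⟨hv.1, hv.2.1, T.C_sub hv.2.2⟩

variable (T : NCCTriple d)

theorem f_ne {x : PSpace d} (hx : x ∈ closure T.Ω) : (toC T).f x.rep ≠ 0 :=
  (chartOf_spec T.properlyConvex_Ω).1 x hx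

theorem f_cmap {x : PSpace d} (hx : x ∈ closure T.Ω) : (toC T).f (cmap T.Ω x) = 1 := by
  have h1 := f_ne T hx
  change (toC T).f (((toC T).f x.rep)⁻¹ • x.rep) = 1
  rw [map_smul, smul_eq_mul, inv_mul_cancel₀ h1]

theorem cmap_ne {x : PSpace d} (hx : x ∈ closure T.Ω) : cmap T.Ω x ≠ 0 :=
  fne (toC T).f (by rw [f_cmap T hx]; exact one_ne_zero)

theorem mk_cmap {x : PSpace d} (hx : x ∈ closure T.Ω) :
    Projectivization.mk ℝ (cmap T.Ω x) (cmap_ne T hx) = x :=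
  (eq_mk_of_chart (toC T).f (cmap_ne T hx) one_ne_zero (by rw [one_smul]; rfl)).symm

theorem cmap_mk {v : Fin d → ℝ} (hv : v ≠ 0) :
    cmap T.Ω (Projectivization.mk ℝ v hv) = ((toC T).f v)⁻¹ • v := chart_mk _ v hv

theorem cmap_mem {A : Set (PSpace d)} (hA : A ⊆ T.Ω) {x : PSpace d} (hx : x ∈ closure A) :
    cmap T.Ω x ∈ closure (coneOf (toC T).f A) := by
  have hx' := closure_mono hA hx
  have h := hx
  rw [← mk_cmap T hx', mem_closure_mk (toC T).f (fun y hy => f_ne T (subset_closure (hA hy)))] at h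
  rcases h with h | h
  · exact h
  · exfalso
    have hsub : coneOf (toC T).f A ⊆ (toC T).I := fun v hv => ⟨hv.1, hv.2.1, hA hv.2.2⟩
    have : -cmap T.Ω x ∈ (toC T).K := closure_mono hsub h
    have := (toC T).Kf this
    rw [map_neg, f_cmap T hx'] at this
    linarith

theorem cmap_K {x : PSpace d} (hx : x ∈ closure T.Ω) : cmap T.Ω x ∈ (toC T).K :=
  cmap_mem T subset_rfl hx

theorem mk_mem {A : Set (PSpace d)} (hA : A ⊆ T.Ω) {v : Fin d → ℝ} (hv : v ≠ 0)
    (h : v ∈ closure (coneOf (toC T).f A)) : Projectivization.mk ℝ v hv ∈ closure A := by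
  rw [mem_closure_mk (toC T).f (fun y hy => f_ne T (subset_closure (hA hy)))]
  exact Or.inl h

theorem mk_K {v : Fin d → ℝ} (hv : v ≠ 0) (h : v ∈ (toC T).K) :
    Projectivization.mk ℝ v hv ∈ closure T.Ω := mk_mem T subset_rfl hv h

theorem mem_I_iff {v : Fin d → ℝ} (hv : v ≠ 0) (h : v ∈ (toC T).K) :
    v ∈ (toC T).I ↔ Projectivization.mk ℝ v hv ∈ T.Ω :=
  ⟨fun h => h.2.2, fun h' => ⟨(toC T).Kfpos h hv, hv, h'⟩⟩

theorem mem_idealBdry {x : PSpace d} (hx : x ∈ idealBdry T.C) :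
    x ∈ closure T.Ω ∧ cmap T.Ω x ∈ (toC T).KC ∧ cmap T.Ω x ∉ (toC T).I := by
  have h1 := closure_mono T.C_sub hx.1
  refine ⟨h1, cmap_mem T T.C_sub hx.1, ?_⟩
  rw [mem_I_iff T (cmap_ne T h1) (cmap_K T h1), mk_cmap T h1]
  exact fun h => hx.2 (T.C_closedInΩ ⟨hx.1, h⟩)

theorem mk_idealBdry {v : Fin d → ℝ} (hv : v ≠ 0) (h : v ∈ (toC T).KC) (hI : v ∉ (toC T).I) :
    Projectivization.mk ℝ v hv ∈ idealBdry T.C :=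
  ⟨mk_mem T T.C_sub hv h, fun h' => hI ((mem_I_iff T hv ((toC T).KCsub h)).2 (T.C_sub h'))⟩

theorem eqv_cmap {v : Fin d → ℝ} (hv : v ≠ 0) (h : v ∈ (toC T).K) :
    (toC T).Eqv v (cmap T.Ω (Projectivization.mk ℝ v hv)) := by
  have h1 := inv_pos.2 ((toC T).Kfpos h hv)
  rw [cmap_mk]
  exact ⟨(toC T).le_smul h1 ((toC T).le_refl v), (toC T).smul_le h1 ((toC T).le_refl v)⟩

theorem face_sub {x : PSpace d} (hx : x ∈ closure T.Ω) : face T.Ω x ⊆ closure T.Ω := by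
  rintro y (rfl | h)
  · exact hx
  · exact h.1

theorem seg_le {Θ : Cset d} {a b x y : Fin d → ℝ} (ha : a ∈ Θ.K) (hb : b ∈ Θ.K)
    (hx : x ∈ openSegment ℝ a b) (hy : y ∈ openSegment ℝ a b) : Θ.Le x y := by
  obtain ⟨s, t, hs, ht, -, rfl⟩ := hx
  obtain ⟨s', t', hs', ht', -, rfl⟩ := hy
  refine Cset.Le.add (Θ.Ksmul hs.le ha) (Θ.Ksmul ht.le hb) ?_ ?_
  · exact (Θ.smul_le hs (Θ.le_smul hs' (Θ.le_refl a))).trans (Θ.le_add_right (Θ.Ksmul ht'.le hb))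
  · exact (Θ.smul_le ht (Θ.le_smul ht' (Θ.le_refl b))).trans (Θ.le_add_left (Θ.Ksmul hs'.le ha))

theorem mem_face {x y : PSpace d} (hx : x ∈ closure T.Ω) (hy : y ∈ closure T.Ω) :
    y ∈ face T.Ω x ↔ (toC T).Eqv (cmap T.Ω x) (cmap T.Ω y) := by
  constructor
  · rintro (rfl | ⟨-, a, ha, b, hb, ⟨-, h1⟩, ⟨-, h2⟩⟩)
    · exact ⟨(toC T).le_refl _, (toC T).le_refl _⟩
    · exact ⟨seg_le (cmap_K T ha) (cmap_K T hb) h1 h2, seg_le (cmap_K T ha) (cmap_K T hb) h2 h1⟩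
  · rintro ⟨⟨s, hs, h1⟩, ⟨t, ht, h2⟩⟩
    set X := cmap T.Ω x with hX
    set Y := cmap T.Ω y with hY
    set δ := min (min s t) (1 / 2) with hδ
    have hδ0 : 0 < δ := by positivity
    have hδ1 : δ < 1 := lt_of_le_of_lt (min_le_right _ _) (by norm_num)
    have hXK : X ∈ (toC T).K := cmap_K T hx
    have hYK : Y ∈ (toC T).K := cmap_K T hy
    have fX : (toC T).f X = 1 := f_cmap T hx
    have fY : (toC T).f Y = 1 := f_cmap T hy
    have h1' : Y - δ • X ∈ (toC T).K := by
      have := (toC T).Kadd h1 ((toC T).Ksmul (t := s - δ)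
        (sub_nonneg.2 ((min_le_left _ _).trans (min_le_left _ _))) hXK)
      convert this using 1; module
    have h2' : X - δ • Y ∈ (toC T).K := by
      have := (toC T).Kadd h2 ((toC T).Ksmul (t := t - δ)
        (sub_nonneg.2 ((min_le_left _ _).trans (min_le_right _ _))) hYK)
      convert this using 1; module
    have n1 : (toC T).f (Y - δ • X) = 1 - δ := by simp [fX, fY]
    have n2 : (toC T).f (X - δ • Y) = 1 - δ := by simp [fX, fY]
    have z1 : Y - δ • X ≠ 0 := fne (toC T).f (by rw [n1]; linarith)
    have z2 : X - δ • Y ≠ 0 := fne (toC T).f (by rw [n2]; linarith)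
    have hd : 1 - δ ≠ 0 := by linarith
    have hd' : 1 + δ ≠ 0 := by linarith
    right
    refine ⟨hy, _, mk_K T z2 h2', _, mk_K T z1 h1', ⟨hx, ?_⟩, ⟨hy, ?_⟩⟩
    · rw [cmap_mk, cmap_mk, n1, n2]
      refine ⟨1 / (1 + δ), δ / (1 + δ), by positivity, by positivity, by field_simp, ?_⟩
      rw [← hX]
      ext i
      simp
      field_simp
      ring
    · rw [cmap_mk, cmap_mk, n1, n2]
      refine ⟨δ / (1 + δ), 1 / (1 + δ), by positivity, by positivity, by field_simp; ring, ?_⟩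
      rw [← hY]
      ext i
      simp
      field_simp
      ring

theorem mk_mem_face {u v : Fin d → ℝ} (hu : u ≠ 0) (hv : v ≠ 0) (huK : u ∈ (toC T).K) (hvK : v ∈ (toC T).K) :
    Projectivization.mk ℝ v hv ∈ face T.Ω (Projectivization.mk ℝ u hu) ↔ (toC T).Eqv u v := by
  rw [mem_face T (mk_K T hu huK) (mk_K T hv hvK)]
  have h1 := eqv_cmap T hu huK
  have h2 := eqv_cmap T hv hvK
  exact ⟨fun h => (h1.trans h).trans h2.symm, fun h => (h1.symm.trans h).trans h2⟩

theorem sign_const {I : Set (Fin d → ℝ)} (hI : ∀ u ∈ I, ∀ v ∈ I, u + v ∈ I)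
    (hs : ∀ t : ℝ, 0 < t → ∀ u ∈ I, t • u ∈ I) (h : (Fin d → ℝ) →ₗ[ℝ] ℝ) (hne : ∀ u ∈ I, h u ≠ 0) :
    (∀ u ∈ I, 0 < h u) ∨ (∀ u ∈ I, h u < 0) := by
  by_contra! hcon
  obtain ⟨⟨u, hu, hu'⟩, v, hv, hv'⟩ := hcon
  have h1 : h u < 0 := lt_of_le_of_ne hu' (hne u hu)
  have h2 : 0 < h v := lt_of_le_of_ne hv' (hne v hv).symm
  refine hne _ (hI _ (hs (h v) h2 u hu) _ (hs (-h u) (by linarith) v hv)) ?_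
  simp; ring

theorem grp : (toC T).Grp := by
  obtain ⟨Kc, hKC, hKc, hcov⟩ := T.cocompact
  refine ⟨cmap T.Ω '' Kc, ?_, ?_, ?_⟩
  · refine hKc.image_of_continuousOn fun x hx => ContinuousAt.continuousWithinAt ?_
    have hx' := subset_closure (T.C_sub (hKC hx))
    have := chart_cont (toC T).f x.rep x.rep_nonzero (f_ne T hx')
    rw [x.mk_rep] at this
    exact this
  · rintro _ ⟨x, hx, rfl⟩
    have hx' := T.C_sub (hKC hx)
    have hx'' := subset_closure hx'
    rwa [mem_I_iff T (cmap_ne T hx'') (cmap_K T hx''), mk_cmap T hx'']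
  · intro p hp hpI
    have hp0 := hpI.2.1
    have hpC : Projectivization.mk ℝ p hp0 ∈ T.C := T.C_closedInΩ ⟨mk_mem T T.C_sub hp0 hp, hpI.2.2⟩
    obtain ⟨g, hg, x, hx, hgx⟩ : ∃ g ∈ T.Λ, ∃ x ∈ Kc, pact g x = Projectivization.mk ℝ p hp0 := by
      have := hcov hpC
      simp only [mem_iUnion, mem_image] at this
      obtain ⟨g, hg, x, hx, h⟩ := this
      exact ⟨g, hg, x, hx, h⟩
    have hg' : g⁻¹ ∈ T.Λ := T.Λ.inv_mem hg
    set k : (Fin d → ℝ) ≃ₗ[ℝ] (Fin d → ℝ) := g⁻¹ with hk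
    have k0 : ∀ v, v ≠ 0 → k v ≠ 0 := fun v hv => by simpa using hv
    have pk : ∀ v (hv : v ≠ 0), pact k (Projectivization.mk ℝ v hv) = Projectivization.mk ℝ (k v) (k0 v hv) :=
      fun v hv => rfl
    have pinj : Function.Injective (pact k) := Projectivization.map_injective _ _
    have kΩ : ∀ v (hv : v ≠ 0), Projectivization.mk ℝ (k v) (k0 v hv) ∈ T.Ω ↔ Projectivization.mk ℝ v hv ∈ T.Ω := by
      intro v hv
      rw [← pk]
      conv_lhs => rw [← T.inv_Ω k hg']
      exact pinj.mem_set_image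
    have kC : ∀ v (hv : v ≠ 0), Projectivization.mk ℝ (k v) (k0 v hv) ∈ T.C ↔ Projectivization.mk ℝ v hv ∈ T.C := by
      intro v hv
      rw [← pk]
      conv_lhs => rw [← T.inv_C k hg']
      exact pinj.mem_set_image
    have hkp : cmap T.Ω (Projectivization.mk ℝ (k p) (k0 p hp0)) ∈ cmap T.Ω '' Kc := by
      refine ⟨x, hx, ?_⟩
      rw [← pk p hp0, ← hgx]
      congr 1
      obtain ⟨v, hv, rfl⟩ : ∃ v, ∃ hv : v ≠ 0, x = Projectivization.mk ℝ v hv :=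
        ⟨x.rep, x.rep_nonzero, x.mk_rep.symm⟩
      have e1 : pact g (Projectivization.mk ℝ v hv) = Projectivization.mk ℝ (g v) (by simpa using hv) := rfl
      rw [e1, pk]
      congr 1
      exact (g.symm_apply_apply v).symm
    have fk : ∀ u ∈ (toC T).I, ((toC T).f ∘ₗ k.toLinearMap) u ≠ 0 := by
      intro u hu
      have := (kΩ u hu.2.1).2 hu.2.2
      exact (frep_mk (toC T).f (k u) (k0 u hu.2.1)).1 (f_ne T (subset_closure this))
    -- a signed, rescaled version
    have fin : ∀ c : ℝ, c ≠ 0 → c = ((toC T).f (k p))⁻¹ → (∀ u ∈ (toC T).I, 0 < (toC T).f (c • k u)) →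
        ∃ g : (Fin d → ℝ) →ₗ[ℝ] (Fin d → ℝ), (∀ v, g v ∈ (toC T).I ↔ v ∈ (toC T).I) ∧
        (∀ v ∈ (toC T).KC, g v ∈ (toC T).KC) ∧ g p ∈ cmap T.Ω '' Kc := by
      intro c hc hcp hpos
      have ck : ∀ v (hv : v ≠ 0) (h : c • k v ≠ 0), Projectivization.mk ℝ (c • k v) h =
          Projectivization.mk ℝ (k v) (k0 v hv) := fun v hv h => mk_smul_eq _ _ _ _
      refine ⟨c • k.toLinearMap, ?_, ?_, ?_⟩
      · intro v
        constructor
        · rintro ⟨h1, h2, h3⟩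
          have h4 : c • k v ≠ 0 := h2
          have hv : v ≠ 0 := by rintro rfl; simp at h4
          have h5 : Projectivization.mk ℝ v hv ∈ T.Ω := by
            rw [← kΩ, ← ck v hv h4]; exact h3
          have h6 : (toC T).f v ≠ 0 := (frep_mk _ v hv).1 (f_ne T (subset_closure h5))
          rcases h6.lt_or_gt with h7 | h7
          · exfalso
            have hv' : -v ≠ 0 := neg_ne_zero.2 hv
            have h8 : -v ∈ (toC T).I := ⟨by change 0 < (toC T).f (-v); rw [map_neg]; linarith, hv', by
              have : Projectivization.mk ℝ (-v) hv' = Projectivization.mk ℝ v hv :=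
                (Projectivization.mk_eq_mk_iff' ℝ _ _ _ _).2 ⟨-1, by simp⟩
              rwa [this]⟩
            have h9 := hpos _ h8
            rw [map_neg, smul_neg, map_neg] at h9
            have h1' : 0 < (toC T).f (c • k v) := h1
            linarith
          · exact ⟨h7, hv, h5⟩
        · intro hv
          refine ⟨hpos v hv, smul_ne_zero hc (k0 v hv.2.1), ?_⟩
          have := (kΩ v hv.2.1).2 hv.2.2
          rw [← ck v hv.2.1 (smul_ne_zero hc (k0 v hv.2.1))] at this
          exact this
      · intro v hv
        refine map_mem_closure (LinearMap.continuous_of_finiteDimensional _) hv ?_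
        intro v hv
        have hvI : v ∈ (toC T).I := ⟨hv.1, hv.2.1, T.C_sub hv.2.2⟩
        refine ⟨hpos v hvI, smul_ne_zero hc (k0 v hv.2.1), ?_⟩
        have := (kC v hv.2.1).2 hv.2.2
        rw [← ck v hv.2.1 (smul_ne_zero hc (k0 v hv.2.1))] at this
        exact this
      · rw [cmap_mk] at hkp
        change c • k p ∈ _
        rw [hcp]; exact hkp
    have hpne := fk p hpI
    refine fin _ (inv_ne_zero hpne) rfl ?_
    intro u hu
    rw [map_smul, smul_eq_mul]
    rcases sign_const (toC T).Iadd (toC T).Ismul ((toC T).f ∘ₗ k.toLinearMap) fk with h | h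
    · exact mul_pos (inv_pos.2 (h p hpI)) (h u hu)
    · exact mul_pos_of_neg_of_neg (inv_lt_zero.2 (h p hpI)) (h u hu)

end

section


theorem closure_real {J : Set ℝ} (hJ : Convex ℝ J) :
    closure J ⊆ J ∪ {sInf J, sSup J} := by
  intro t ht
  by_cases hJt : t ∈ J
  · exact Or.inl hJt
  right
  have hne : J.Nonempty := closure_nonempty_iff.1 ⟨t, ht⟩
  by_cases h1 : t ∈ upperBounds J
  · right
    exact ((isLUB_of_mem_closure h1 ht).csSup_eq hne).symm
  · left
    have h2 : t ∈ lowerBounds J := by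
      intro s hs
      by_contra hlt
      push Not at hlt
      simp only [upperBounds, mem_ofPred_eq, not_forall, not_le] at h1
      obtain ⟨r, hr, hrt⟩ := h1
      exact hJt (hJ.ordConnected.out hs hr ⟨hlt.le, hrt.le⟩)
    exact ((isGLB_of_mem_closure h2 ht).csInf_eq hne).symm

theorem oneDim {B : Set (Fin d → ℝ)} (hB : Convex ℝ B)
    (h : Module.finrank ℝ (affineSpan ℝ B).direction ≤ 1) :
    ∃ q₁ q₂, closure B ⊆ B ∪ {q₁, q₂} := by
  rcases B.eq_empty_or_nonempty with rfl | ⟨p, hp⟩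
  · exact ⟨0, 0, by simp⟩
  obtain ⟨⟨w, hw⟩, hspan⟩ := finrank_le_one_iff.1 h
  have hpar : ∀ b ∈ B, ∃ c : ℝ, b = p + c • w := by
    intro b hb
    have : b - p ∈ (affineSpan ℝ B).direction :=
      AffineSubspace.vsub_mem_direction (subset_affineSpan ℝ _ hb) (subset_affineSpan ℝ _ hp)
    obtain ⟨c, hc⟩ := hspan ⟨_, this⟩
    refine ⟨c, ?_⟩
    have := congrArg Subtype.val hc
    simp only [Submodule.coe_smul] at this
    rw [this]; abel
  by_cases hw0 : w = 0
  · refine ⟨p, p, ?_⟩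
    have : B ⊆ {p} := fun b hb => by
      obtain ⟨c, hc⟩ := hpar b hb
      rw [hc, hw0, smul_zero, add_zero]; rfl
    refine (closure_mono this).trans ?_
    rw [closure_singleton]
    intro x hx
    right; left; exact hx
  set φ : ℝ → Fin d → ℝ := fun t => p + t • w with hφ
  have hcl : Topology.IsClosedEmbedding φ :=
    (Homeomorph.addLeft p).isClosedEmbedding.comp (isClosedEmbedding_smul_left hw0)
  set J := φ ⁻¹' B with hJ
  have hJB : φ '' J = B := by
    apply image_preimage_eq_of_subset
    intro b hb
    obtain ⟨c, hc⟩ := hpar b hb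
    exact ⟨c, hc.symm⟩
  have hJc : Convex ℝ J := by
    intro s hs t ht a b ha hb hab
    have h1 := hB hs ht ha hb hab
    change φ (a • s + b • t) ∈ B
    convert h1 using 1
    have h2 : b = 1 - a := by linarith
    simp only [hφ, smul_eq_mul, h2]
    module
  refine ⟨φ (sInf J), φ (sSup J), ?_⟩
  conv_lhs => rw [← hJB]
  rw [hcl.closure_image_eq]
  rintro _ ⟨t, ht, rfl⟩
  rcases closure_real hJc ht with h | h | h
  · exact Or.inl h
  · rw [h]; right; left; rfl
  · rw [h]; right; right; rfl

theorem hilb {O : Set (Fin d → ℝ)} (hO : Bornology.IsBounded O) {u v : Fin d → ℝ} {R : ℝ}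
    (huv : u ≠ v) (h1 : ∃ t : ℝ, t < 0 ∧ u + t • (v - u) ∈ O) (h2 : ∃ t : ℝ, 1 < t ∧ u + t • (v - u) ∈ O)
    (hd : hilbertDistChart O u v < R) :
    (∃ t : ℝ, t < -Real.exp (-(2 * R)) ∧ u + t • (v - u) ∈ O) ∧
    (∃ t : ℝ, 1 + Real.exp (-(2 * R)) < t ∧ u + t • (v - u) ∈ O) := by
  rw [hilbertDistChart, if_neg huv] at hd
  set J := {t : ℝ | u + t • (v - u) ∈ O} with hJ
  have hw : v - u ≠ 0 := sub_ne_zero.2 huv.symm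
  have hb : Bornology.IsBounded J := by
    obtain ⟨M, hM⟩ := hO.exists_norm_le
    refine (Metric.isBounded_closedBall (x := (0 : ℝ)) (r := (M + ‖u‖) / ‖v - u‖)).subset ?_
    intro t ht
    have h3 := hM _ ht
    have h4 : ‖t • (v - u)‖ ≤ M + ‖u‖ := by
      calc ‖t • (v - u)‖ = ‖(u + t • (v - u)) - u‖ := by congr 1; abel
        _ ≤ _ := (norm_sub_le _ _).trans (by linarith)
    rw [norm_smul] at h4
    rw [mem_closedBall_zero_iff, le_div_iff₀ (norm_pos_iff.2 hw)]
    exact h4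
  obtain ⟨s, hs, hsO⟩ := h1
  obtain ⟨t, ht, htO⟩ := h2
  have hm : sInf J < 0 := lt_of_le_of_lt (csInf_le hb.bddBelow hsO) hs
  have hP : 1 < sSup J := lt_of_lt_of_le ht (le_csSup hb.bddAbove htO)
  have hne : J.Nonempty := ⟨s, hsO⟩
  set P := sSup J
  set m := sInf J
  have e : Real.exp (-(2 * R)) = (Real.exp (2 * R))⁻¹ := Real.exp_neg _
  have hpos : 0 < P * (1 - m) / (-m * (P - 1)) :=
    div_pos (mul_pos (by linarith) (by linarith)) (mul_pos (by linarith) (by linarith))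
  have h5 : P * (1 - m) / (-m * (P - 1)) < Real.exp (2 * R) := by
    rw [← Real.log_lt_iff_lt_exp hpos]; linarith
  rw [div_lt_iff₀ (mul_pos (by linarith) (by linarith))] at h5
  set E := Real.exp (2 * R)
  have hE : 0 < E := Real.exp_pos _
  rw [e]
  have h6 : 1 < E * (P - 1) := by
    by_contra! hc
    nlinarith [mul_le_mul_of_nonneg_left hc (by linarith : 0 ≤ -m)]
  have h7 : 1 < E * (-m) := by
    by_contra! hc
    nlinarith [mul_le_mul_of_nonneg_left hc (by linarith : 0 ≤ P - 1)]
  constructor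
  · have : m < -E⁻¹ := by
      have : E⁻¹ < -m := by rwa [inv_lt_iff_one_lt_mul₀' hE]
      linarith
    obtain ⟨t, ht, h⟩ := exists_lt_of_csInf_lt hne this
    exact ⟨t, h, ht⟩
  · have : 1 + E⁻¹ < P := by
      have : E⁻¹ < P - 1 := by rwa [inv_lt_iff_one_lt_mul₀' hE]
      linarith
    obtain ⟨t, ht, h⟩ := exists_lt_of_lt_csSup hne this
    exact ⟨t, h, ht⟩

variable (T : NCCTriple d)

theorem face_cone {X : Fin d → ℝ} (hX : X ≠ 0) (hXK : X ∈ (toC T).K) {Y : Fin d → ℝ} :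
    Y ∈ coneOf (toC T).f (face T.Ω (Projectivization.mk ℝ X hX)) ↔
      Y ≠ 0 ∧ Y ∈ (toC T).K ∧ (toC T).Eqv X Y := by
  constructor
  · rintro ⟨h1, h2, h3⟩
    have hK : Y ∈ (toC T).K := by
      have h4 := cmap_K T (face_sub T (mk_K T hX hXK) h3)
      rw [cmap_mk] at h4
      have := (toC T).Ksmul h1.le h4
      rwa [smul_inv_smul₀ h1.ne'] at this
    exact ⟨h2, hK, (mk_mem_face T hX h2 hXK hK).1 h3⟩
  · rintro ⟨h1, h2, h3⟩
    exact ⟨(toC T).Kfpos h2 h1, h1, (mk_mem_face T hX h1 hXK h2).2 h3⟩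

theorem eqv_add {Θ : Cset d} {X Y Z : Fin d → ℝ} (hY : Y ∈ Θ.K) (hZ : Z ∈ Θ.K) (h1 : Θ.Eqv X Y)
    (h2 : Θ.Eqv X Z) : Θ.Eqv X (Y + Z) :=
  ⟨h1.1.trans (Θ.le_add_right hZ), Cset.Le.add hY hZ h1.2 h2.2⟩

theorem eqv_smul {Θ : Cset d} {X Y : Fin d → ℝ} {t : ℝ} (ht : 0 < t) (h1 : Θ.Eqv X Y) : Θ.Eqv X (t • Y) :=
  ⟨Θ.le_smul ht h1.1, Θ.smul_le ht h1.2⟩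

theorem face_pc {X : Fin d → ℝ} (hX : X ≠ 0) (hXK : X ∈ (toC T).K) :
    IsProperlyConvex (face T.Ω (Projectivization.mk ℝ X hX)) := by
  set F := face T.Ω (Projectivization.mk ℝ X hX) with hF
  have hsub : F ⊆ closure T.Ω := face_sub T (mk_K T hX hXK)
  have key : chartMap (toC T).f '' F = {Y | (toC T).f Y = 1 ∧ Y ≠ 0 ∧ Y ∈ (toC T).K ∧ (toC T).Eqv X Y} := by
    ext Y
    constructor
    · rintro ⟨z, hz, rfl⟩
      have hz' := hsub hz
      refine ⟨f_cmap T hz', ?_⟩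
      rw [← face_cone T hX hXK]
      refine ⟨?_, cmap_ne T hz', ?_⟩
      · have := f_cmap T hz'
        change 0 < (toC T).f (cmap T.Ω z); rw [this]; exact one_pos
      · have := mk_cmap T hz'
        change Projectivization.mk ℝ (cmap T.Ω z) _ ∈ _
        rw [this]; exact hz
    · rintro ⟨h1, h2⟩
      have h3 := (face_cone T hX hXK).2 h2
      rw [mem_cone_iff _ (by rw [h1]; exact one_pos), h1, inv_one, one_smul] at h3
      exact h3
  refine ⟨(toC T).f, ?_, ?_, ?_⟩
  · intro x hx
    exact f_ne T (closure_minimal hsub isClosed_closure hx)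
  · rw [key, convex_iff_forall_pos]
    rintro Y ⟨h1, h2, h3, h4⟩ Z ⟨g1, g2, g3, g4⟩ a b ha hb hab
    have k1 := (toC T).Ksmul ha.le h3
    have k2 := (toC T).Ksmul hb.le g3
    refine ⟨by simp [h1, g1, hab], ?_, (toC T).Kadd k1 k2, eqv_add k1 k2 (eqv_smul ha h4) (eqv_smul hb g4)⟩
    exact Cset.Kne k1 k2 (smul_ne_zero ha.ne' h2)
  · rw [key, isBounded_iff_forall_norm_le]
    refine ⟨(toC T).M, ?_⟩
    rintro Y ⟨h1, h2, h3, h4⟩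
    have := (toC T).Kbd h3
    rwa [h1, mul_one] at this

theorem face_data {X : Fin d → ℝ} (hX : X ≠ 0) (hXK : X ∈ (toC T).K) :
    ∃ (G : (Fin d → ℝ) →ₗ[ℝ] ℝ) (σ : ℝ), σ * σ = 1 ∧
      (∀ Y ∈ (toC T).K, Y ≠ 0 → (toC T).Le Y X → 0 < G Y) ∧
      (∀ Y (hY : Y ≠ 0), cmap (face T.Ω (Projectivization.mk ℝ X hX)) (Projectivization.mk ℝ Y hY) =
        σ • (G Y)⁻¹ • Y) := by
  set F := face T.Ω (Projectivization.mk ℝ X hX) with hF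
  obtain ⟨hne, -, -⟩ := chartOf_spec (face_pc T hX hXK)
  rw [← hF] at hne
  have hsub : F ⊆ closure T.Ω := face_sub T (mk_K T hX hXK)
  set C := {Y | Y ≠ 0 ∧ Y ∈ (toC T).K ∧ (toC T).Eqv X Y} with hC
  have hne1 : ∀ Y ∈ (toC T).K, Y ≠ 0 → (toC T).Le Y X → chartOf F Y ≠ 0 := by
    intro Y hY hY0 hle
    refine (frep_mk _ Y hY0).1 (hne _ ?_)
    rw [mem_closure_mk (toC T).f (fun y hy => f_ne T (hsub hy))]
    left
    have hl : Tendsto (fun n : ℕ => Y + (1 / ((n : ℝ) + 1)) • X) atTop (nhds (Y + (0 : ℝ) • X)) :=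
      tendsto_const_nhds.add (tendsto_one_div_add_atTop_nhds_zero_nat.smul_const X)
    rw [zero_smul, add_zero] at hl
    refine mem_closure_of_tendsto hl (Eventually.of_forall fun n => ?_)
    have hp : (0 : ℝ) < 1 / ((n : ℝ) + 1) := by positivity
    have k1 := (toC T).Ksmul hp.le hXK
    refine (face_cone T hX hXK).2 ⟨Cset.Kne hY k1 hY0, (toC T).Kadd hY k1, ?_, ?_⟩
    · exact ((toC T).le_smul hp ((toC T).le_refl X)).trans ((toC T).le_add_left hY)
    · exact Cset.Le.add hY k1 hle ((toC T).smul_le hp ((toC T).le_refl X))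
  have hsign := sign_const (I := {Y | Y ≠ 0 ∧ Y ∈ (toC T).K ∧ (toC T).Le Y X})
    (by
      rintro u ⟨h1, h2, h3⟩ v ⟨g1, g2, g3⟩
      exact ⟨Cset.Kne h2 g2 h1, (toC T).Kadd h2 g2, Cset.Le.add h2 g2 h3 g3⟩)
    (by
      rintro t ht u ⟨h1, h2, h3⟩
      exact ⟨smul_ne_zero ht.ne' h1, (toC T).Ksmul ht.le h2, (toC T).smul_le ht h3⟩)
    (chartOf F) (by rintro u ⟨h1, h2, h3⟩; exact hne1 u h2 h1 h3)
  rcases hsign with h | h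
  · refine ⟨chartOf F, 1, by norm_num, fun Y h1 h2 h3 => h Y ⟨h2, h1, h3⟩, fun Y hY => ?_⟩
    rw [one_smul]; exact chart_mk _ Y hY
  · refine ⟨-chartOf F, -1, by norm_num, fun Y h1 h2 h3 => ?_, fun Y hY => ?_⟩
    · have := h Y ⟨h2, h1, h3⟩
      simpa using this
    · have := chart_mk (chartOf F) Y hY
      rw [cmap, this]; simp [inv_neg]

end

section

variable (T : NCCTriple d)

theorem near {X : Fin d → ℝ} (hX : X ≠ 0) (hXK : X ∈ (toC T).K) {G : (Fin d → ℝ) →ₗ[ℝ] ℝ} {σ : ℝ}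
    (hσ : σ * σ = 1) (hG : ∀ Y ∈ (toC T).K, Y ≠ 0 → (toC T).Le Y X → 0 < G Y)
    (hcm : ∀ Y (hY : Y ≠ 0), cmap (face T.Ω (Projectivization.mk ℝ X hX)) (Projectivization.mk ℝ Y hY) =
        σ • (G Y)⁻¹ • Y) {P Q : Fin d → ℝ} (hP : P ≠ 0) (hPK : P ∈ (toC T).K) (hPX : (toC T).Eqv X P)
    (hGP : G P = 1) (hQ : Q ≠ 0) (hQK : Q ∈ (toC T).K) (hQX : (toC T).Eqv X Q) (hGQ : G Q = 1) {R : ℝ}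
    (hd : hilbertDist (face T.Ω (Projectivization.mk ℝ X hX)) (Projectivization.mk ℝ P hP)
      (Projectivization.mk ℝ Q hQ) < R) :
    Q - (Real.exp (-(2 * R)) / (1 + Real.exp (-(2 * R)))) • P ∈ (toC T).K ∧
    P - (Real.exp (-(2 * R)) / (1 + Real.exp (-(2 * R)))) • Q ∈ (toC T).K := by
  set F := face T.Ω (Projectivization.mk ℝ X hX) with hF
  set e := Real.exp (-(2 * R)) with he
  have he0 : 0 < e := Real.exp_pos _
  by_cases hPQ : P = Q
  · subst hPQ
    have : P - (e / (1 + e)) • P ∈ (toC T).K := by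
      have h1 : P - (e / (1 + e)) • P = (1 / (1 + e)) • P := by
        have : 1 / (1 + e) = 1 - e / (1 + e) := by field_simp; ring
        rw [this]; module
      rw [h1]; exact (toC T).Ksmul (by positivity) hPK
    exact ⟨this, this⟩
  have hO1 : ∀ W ∈ (toC T).K, W ≠ 0 → (toC T).Eqv X W → G W = 1 → σ • W ∈ cmap F '' F := by
    intro W h1 h2 h3 h4
    refine ⟨_, (mk_mem_face T hX h2 hXK h1).2 h3, ?_⟩
    rw [hcm, h4, inv_one, one_smul]
  have hO2 : ∀ W, σ • W ∈ cmap F '' F → W ∈ (toC T).K := by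
    rintro W ⟨z, hz, h⟩
    have hz' := face_sub T (mk_K T hX hXK) hz
    have hE := (mem_face T (mk_K T hX hXK) hz').1 hz
    have hE' := (eqv_cmap T hX hXK).trans hE
    rw [← mk_cmap T hz', hcm] at h
    have h1 := congrArg (fun v => σ • v) h
    simp only [smul_smul, ← mul_assoc, hσ, one_mul, one_smul] at h1
    rw [← h1]
    exact (toC T).Ksmul (inv_nonneg.2 (hG _ (cmap_K T hz') (cmap_ne T hz') hE'.2).le) (cmap_K T hz')
  have hline : ∀ t : ℝ, σ • P + t • (σ • Q - σ • P) = σ • (P + t • (Q - P)) := fun t => by module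
  have hσ0 : σ ≠ 0 := by rintro rfl; simp at hσ
  rw [hilbertDist, hcm, hcm, hGP, hGQ, inv_one, one_smul, one_smul] at hd
  have ext : ∀ P Q : Fin d → ℝ, P ≠ 0 → P ∈ (toC T).K → (toC T).Eqv X P → G P = 1 → Q ∈ (toC T).K →
      (toC T).Eqv X Q → G Q = 1 → ∃ t : ℝ, 0 < t ∧ σ • (P - t • (Q - P)) ∈ cmap F '' F := by
    intro P Q hP hPK hPX hGP hQK hQX hGQ
    obtain ⟨s, hs, h⟩ := hQX.2.trans hPX.1
    have e1 : P - (s / 2) • (Q - P) = (1 / 2 : ℝ) • (P - s • Q) + (1 / 2 + s / 2) • P := by module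
    have k1 := (toC T).Ksmul (t := 1 / 2) (by norm_num) h
    have hs2 : 0 < 1 / 2 + s / 2 := by positivity
    have k2 := (toC T).Ksmul (t := 1 / 2 + s / 2) hs2.le hPK
    refine ⟨s / 2, by positivity, hO1 _ ?_ ?_ ⟨?_, ?_⟩ (by simp [hGP, hGQ])⟩
    · rw [e1]; exact (toC T).Kadd k1 k2
    · rw [e1, add_comm]; exact Cset.Kne k2 k1 (smul_ne_zero hs2.ne' hP)
    · rw [e1]
      exact hPX.1.trans (((toC T).le_smul hs2 ((toC T).le_refl P)).trans ((toC T).le_add_left k1))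
    · refine Cset.Le.trans ?_ hPX.2
      have h3 : (toC T).Le (P - (s / 2) • (Q - P)) ((1 + s / 2) • P) := by
        apply (toC T).le_of_sub
        have := (toC T).Ksmul (t := s / 2) (by positivity) hQK
        convert this using 1
        module
      exact h3.trans ((toC T).smul_le (by positivity) ((toC T).le_refl P))
  have hb := (chartOf_spec (face_pc T hX hXK)).2.2
  obtain ⟨⟨s, hs, hsO⟩, ⟨t, ht, htO⟩⟩ := hilb hb (u := σ • P) (v := σ • Q) (R := R)
    (fun h => hPQ (smul_right_injective _ hσ0 h))
    (by
      obtain ⟨t, ht, h⟩ := ext P Q hP hPK hPX hGP hQK hQX hGQ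
      refine ⟨-t, by linarith, ?_⟩
      rw [hline, neg_smul, ← sub_eq_add_neg]; exact h)
    (by
      obtain ⟨t, ht, h⟩ := ext Q P hQ hQK hQX hGQ hPK hPX hGP
      refine ⟨1 + t, by linarith, ?_⟩
      rw [hline]
      have e2 : P + (1 + t) • (Q - P) = Q - t • (P - Q) := by module
      rw [e2]; exact h)
    hd
  rw [hline] at hsO htO
  have k1 := hO2 _ hsO
  have k2 := hO2 _ htO
  rw [← he] at hs ht
  have ht0 : 0 < t := by linarith
  have hs0 : 0 < 1 - s := by linarith
  have he1 : 0 < 1 + e := by linarith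
  constructor
  · have h1 := (toC T).Ksmul (t := 1 / t) (by positivity) k2
    have h2 := (toC T).Ksmul (t := (t - 1) / t - e / (1 + e)) (by
      rw [sub_nonneg, div_le_div_iff₀ he1 ht0]; nlinarith) hPK
    convert (toC T).Kadd h1 h2 using 1
    ext i
    simp
    field_simp
    ring
  · have h1 := (toC T).Ksmul (t := 1 / (1 - s)) (by positivity) k1
    have h2 := (toC T).Ksmul (t := (-s) / (1 - s) - e / (1 + e)) (by
      rw [sub_nonneg, div_le_div_iff₀ he1 hs0]; nlinarith) hQK
    convert (toC T).Kadd h1 h2 using 1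
    ext i
    simp
    field_simp
    ring

theorem hilbertDist_self (F : Set (PSpace d)) (p : PSpace d) : hilbertDist F p p = 0 := by
  rw [hilbertDist, hilbertDistChart, if_pos rfl]

theorem hyp (hcdim : ∀ x ∈ idealBdry T.C, cdim (face T.Ω x) (idealBdry T.C ∩ face T.Ω x) ≤ 1) :
    (toC T).Hyp := by
  intro X hXC hX hXI
  have hXK := (toC T).KCsub hXC
  obtain ⟨G, σ, hσ, hG, hcm⟩ := face_data T hX hXK
  have hc := hcdim _ (mk_idealBdry T hX hXC hXI)
  set F := face T.Ω (Projectivization.mk ℝ X hX) with hF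
  have hσ0 : σ ≠ 0 := by rintro rfl; simp at hσ
  have hmem := Nat.sInf_mem (s := {k : ℕ | ∃ R : ℝ, 0 < R ∧ ∃ B : Set (PSpace d), B ⊆ F ∧
    Convex ℝ (cmap F '' B) ∧ pdimIn F B = k ∧
    idealBdry T.C ∩ F ⊆ {p ∈ F | ∃ q ∈ B, hilbertDist F p q < R}})
    ⟨_, 1, one_pos, F, subset_rfl, (chartOf_spec (face_pc T hX hXK)).2.1, rfl,
      fun p hp => ⟨hp.2, p, hp.2, by rw [hilbertDist_self]; exact one_pos⟩⟩
  obtain ⟨R, hR, B, hBF, hBc, hdim, hcov⟩ := hmem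
  have hdim1 : Module.finrank ℝ (affineSpan ℝ (cmap F '' B)).direction ≤ 1 := by
    change pdimIn F B ≤ 1
    rw [hdim]; exact hc
  obtain ⟨q₁, q₂, hq⟩ := oneDim hBc hdim1
  set e := Real.exp (-(2 * R)) with he
  have he0 : 0 < e := Real.exp_pos _
  set δ := e / (1 + e) with hδ
  have hδ0 : 0 < δ := by positivity
  -- elements of B
  have hBel : ∀ β ∈ cmap F '' B, (toC T).Eqv X (σ • β) ∧ σ • β ∈ (toC T).K ∧ σ • β ≠ 0 ∧ G (σ • β) = 1 := by
    rintro _ ⟨z, hz, rfl⟩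
    have hz' := face_sub T (mk_K T hX hXK) (hBF hz)
    have hE' := (eqv_cmap T hX hXK).trans ((mem_face T (mk_K T hX hXK) hz').1 (hBF hz))
    set Z := cmap T.Ω z with hZ
    have hZK : Z ∈ (toC T).K := cmap_K T hz'
    have hZ0 : Z ≠ 0 := cmap_ne T hz'
    have hGZ := hG Z hZK hZ0 hE'.2
    have h1 : σ • cmap F z = (G Z)⁻¹ • Z := by
      rw [← mk_cmap T hz', hcm, smul_smul, hσ, one_smul]
    rw [h1]
    refine ⟨eqv_smul (inv_pos.2 hGZ) hE', (toC T).Ksmul (inv_nonneg.2 hGZ.le) hZK,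
      smul_ne_zero (inv_ne_zero hGZ.ne') hZ0, ?_⟩
    rw [map_smul, smul_eq_mul, inv_mul_cancel₀ hGZ.ne']
  have main : ∀ Y ∈ (toC T).KC, (toC T).Eqv X Y → Y ≠ 0 → ∃ β ∈ cmap F '' B,
      σ • β - δ • (G Y)⁻¹ • Y ∈ (toC T).K ∧ (G Y)⁻¹ • Y - δ • σ • β ∈ (toC T).K := by
    intro Y hYC hXY hY
    have hYK := (toC T).KCsub hYC
    have hYI : Y ∉ (toC T).I := fun h => hXI ((toC T).I_of_le h hXY.2)
    have hGY := hG Y hYK hY hXY.2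
    obtain ⟨hyF, z, hz, hdz⟩ := hcov ⟨mk_idealBdry T hY hYC hYI, (mk_mem_face T hX hY hXK hYK).2 hXY⟩
    obtain ⟨b1, b2, b3, b4⟩ := hBel _ (mem_image_of_mem _ hz)
    refine ⟨_, mem_image_of_mem _ hz, ?_⟩
    have hz' := face_sub T (mk_K T hX hXK) (hBF hz)
    have hY' : (G Y)⁻¹ • Y ≠ 0 := smul_ne_zero (inv_ne_zero hGY.ne') hY
    have ez : z = Projectivization.mk ℝ (σ • cmap F z) b3 := by
      refine eq_mk_of_chart (chartOf F) b3 hσ0 ?_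
      rw [smul_smul, hσ, one_smul]; rfl
    have hdz' : hilbertDist F (Projectivization.mk ℝ ((G Y)⁻¹ • Y) hY')
        (Projectivization.mk ℝ (σ • cmap F z) b3) < R := by
      rw [mk_smul_eq Y hY _ hY', ← ez]; exact hdz
    exact near T hX hXK hσ hG hcm hY' ((toC T).Ksmul (inv_nonneg.2 hGY.le) hYK)
      (eqv_smul (inv_pos.2 hGY) hXY)
      (by rw [map_smul, smul_eq_mul, inv_mul_cancel₀ hGY.ne']) b3 b2 b1 b4 hdz'
  refine ⟨G, σ • q₁, σ • q₂, δ, hδ0, ?_⟩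
  intro y hyC hy hyX hXy
  have hyK := (toC T).KCsub hyC
  have hGy := hG y hyK hy hyX
  refine ⟨hGy, ?_⟩
  set yn : ℕ → Fin d → ℝ := fun n => y + (1 / ((n : ℝ) + 1)) • X with hyn
  have hl : Tendsto yn atTop (nhds y) := by
    have : Tendsto yn atTop (nhds (y + (0 : ℝ) • X)) :=
      tendsto_const_nhds.add (tendsto_one_div_add_atTop_nhds_zero_nat.smul_const X)
    simpa using this
  have hβ : ∀ n, ∃ β ∈ cmap F '' B,
      σ • β - δ • (G (yn n))⁻¹ • yn n ∈ (toC T).K ∧ (G (yn n))⁻¹ • yn n - δ • σ • β ∈ (toC T).K := by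
    intro n
    have hp : (0 : ℝ) < 1 / ((n : ℝ) + 1) := by positivity
    have k1 := (toC T).Ksmul hp.le hXK
    refine main _ ((toC T).KCadd _ hyC _ ((toC T).KCsmul _ hp.le _ hXC)) ⟨?_, ?_⟩ (Cset.Kne hyK k1 hy)
    · exact ((toC T).le_smul hp ((toC T).le_refl X)).trans ((toC T).le_add_left hyK)
    · exact Cset.Le.add hyK k1 hyX ((toC T).smul_le hp ((toC T).le_refl X))
  choose β hβB hβ1 hβ2 using hβ
  have hbd : Bornology.IsBounded (cmap F '' B) :=
    (chartOf_spec (face_pc T hX hXK)).2.2.subset (image_mono hBF)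
  obtain ⟨q, hqc, φ, hφ, hlim⟩ := tendsto_subseq_of_bounded hbd hβB
  have hl' := hl.comp hφ.tendsto_atTop
  have hGc : Continuous G := G.continuous_of_finiteDimensional
  have hz : Tendsto (fun n => (G (yn (φ n)))⁻¹ • yn (φ n)) atTop (nhds ((G y)⁻¹ • y)) :=
    (((hGc.tendsto y).comp hl').inv₀ hGy.ne').smul hl'
  have r1 : σ • q - δ • (G y)⁻¹ • y ∈ (toC T).K :=
    (toC T).Kcl.mem_of_tendsto ((hlim.const_smul σ).sub (hz.const_smul δ))
      (Eventually.of_forall fun n => hβ1 (φ n))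
  have r2 : (G y)⁻¹ • y - δ • σ • q ∈ (toC T).K :=
    (toC T).Kcl.mem_of_tendsto (hz.sub ((hlim.const_smul σ).const_smul δ))
      (Eventually.of_forall fun n => hβ2 (φ n))
  refine ⟨σ • q, ?_, r1, r2⟩
  rcases hq hqc with h | h | h
  · exfalso
    apply hXy
    have h1 := (hBel q h).1.1.trans (⟨δ, hδ0, r2⟩ : (toC T).Le _ _)
    have := (toC T).le_smul hGy h1
    rwa [smul_inv_smul₀ hGy.ne'] at this
  · left; rw [h]
  · right; rw [h]

end

section

variable (T : NCCTriple d)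

def vecs (d : ℕ) : (Fin 3 → ℝ) →ₗ[ℝ] (Fin d → ℝ) where
  toFun a := fun m => if h : (m : ℕ) < 3 then a ⟨m, h⟩ else 0
  map_add' a b := by
    ext m
    simp only [Pi.add_apply]
    split_ifs <;> simp
  map_smul' c a := by
    ext m
    simp only [Pi.smul_apply, RingHom.id_apply]
    split_ifs <;> simp

theorem vecs_apply (hd : 3 ≤ d) (a : Fin 3 → ℝ) (i : Fin 3) : vecs d a (Fin.castLE hd i) = a i := by
  simp [vecs]

theorem vecs_inj (hd : 3 ≤ d) : Function.Injective (vecs d) := by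
  intro a b h
  ext i
  rw [← vecs_apply hd a i, h, vecs_apply]

theorem vecs_cone (hd : 3 ≤ d) : simplexCone (d := d) 3 = vecs d '' {a | ∀ i, 0 < a i} := by
  ext v
  constructor
  · rintro ⟨h1, h2⟩
    refine ⟨fun i => v (Fin.castLE hd i), fun i => h1 _ (by simp), ?_⟩
    ext m
    by_cases hm : (m : ℕ) < 3
    · simp [vecs, hm]
    · simp [vecs, hm, h2 m (not_lt.1 hm)]
  · rintro ⟨a, ha, rfl⟩
    refine ⟨fun i hi => ?_, fun i hi => ?_⟩
    · simp only [vecs, LinearMap.coe_mk, AddHom.coe_mk, dif_pos hi]; exact ha _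
    · simp [vecs, not_lt.2 hi]

theorem simplex_param {S : Set (PSpace d)} (hS : IsSimplexOfDim 2 S) (hSΩ : S ⊆ T.Ω) :
    ∃ W : (Fin 3 → ℝ) →ₗ[ℝ] (Fin d → ℝ), Function.Injective W ∧
      coneOf (toC T).f S = W '' {a | ∀ i, 0 < a i} := by
  obtain ⟨hd, g, hg⟩ := hS
  have hd : 3 ≤ d := hd
  have hg : S = {q : PSpace d | ∃ v ∈ simplexCone (d := d) 3, ∃ hv : v ≠ 0,
        q = Projectivization.mk ℝ (g v) (by simpa using hv)} := hg
  rw [vecs_cone hd] at hg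
  set W0 : (Fin 3 → ℝ) →ₗ[ℝ] (Fin d → ℝ) := g.toLinearMap ∘ₗ vecs d with hW0
  have hinj : Function.Injective W0 := g.injective.comp (vecs_inj hd)
  have ne0 : ∀ a : Fin 3 → ℝ, (∀ i, 0 < a i) → a ≠ 0 := by
    rintro a h rfl; exact (h 0).ne' rfl
  have hW0' : ∀ a : Fin 3 → ℝ, a ≠ 0 → W0 a ≠ 0 := fun a ha h => ha (hinj (by rw [h, map_zero]))
  have hS' : ∀ q, q ∈ S ↔ ∃ a : Fin 3 → ℝ, (∀ i, 0 < a i) ∧ ∃ h : W0 a ≠ 0, q = Projectivization.mk ℝ (W0 a) h := by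
    intro q
    rw [hg]
    constructor
    · rintro ⟨_, ⟨a, ha, rfl⟩, hv, rfl⟩
      exact ⟨a, ha, hW0' a (ne0 a ha), rfl⟩
    · rintro ⟨a, ha, h, rfl⟩
      exact ⟨_, ⟨a, ha, rfl⟩, fun h0 => h (by change g (vecs d a) = 0; rw [h0, map_zero]), rfl⟩
  have fin : ∀ W : (Fin 3 → ℝ) →ₗ[ℝ] (Fin d → ℝ), Function.Injective W →
      (∀ a : Fin 3 → ℝ, (∀ i, 0 < a i) → 0 < (toC T).f (W a)) →
      (∀ q, q ∈ S ↔ ∃ a : Fin 3 → ℝ, (∀ i, 0 < a i) ∧ ∃ h : W a ≠ 0, q = Projectivization.mk ℝ (W a) h) →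
      coneOf (toC T).f S = W '' {a | ∀ i, 0 < a i} := by
    intro W hWi hW1 hW2
    ext v
    constructor
    · rintro ⟨h1, h2, h3⟩
      obtain ⟨a, ha, h4, h5⟩ := (hW2 _).1 h3
      obtain ⟨c, hc⟩ := (Projectivization.mk_eq_mk_iff' ℝ _ _ _ _).1 h5
      have h6 := hW1 a ha
      have hc0 : 0 < c := by
        rw [← hc, map_smul, smul_eq_mul] at h1
        exact (pos_iff_pos_of_mul_pos h1).2 h6
      exact ⟨c • a, fun i => mul_pos hc0 (ha i), by rw [map_smul, hc]⟩
    · rintro ⟨a, ha, rfl⟩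
      have h1 := hW1 a ha
      exact ⟨h1, fne _ h1.ne', (hW2 _).2 ⟨a, ha, _, rfl⟩⟩
  have hfne : ∀ a ∈ {a : Fin 3 → ℝ | ∀ i, 0 < a i}, ((toC T).f ∘ₗ W0) a ≠ 0 := by
    intro a ha
    have h := hW0' a (ne0 a ha)
    exact (frep_mk _ _ h).1 (f_ne T (subset_closure (hSΩ ((hS' _).2 ⟨a, ha, h, rfl⟩))))
  rcases sign_const (I := {a : Fin 3 → ℝ | ∀ i, 0 < a i}) (fun u hu v hv i => add_pos (hu i) (hv i))
    (fun t ht u hu i => mul_pos ht (hu i)) ((toC T).f ∘ₗ W0) hfne with h | h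
  · exact ⟨W0, hinj, fin W0 hinj (fun a ha => h a ha) hS'⟩
  · have hinj' : Function.Injective (-W0) := fun a b hab => hinj (neg_injective hab)
    refine ⟨-W0, hinj', fin _ hinj' (fun a ha => ?_) ?_⟩
    · have := h a ha
      simp only [LinearMap.comp_apply] at this
      simpa using this
    · intro q
      rw [hS']
      have e : ∀ a (h : W0 a ≠ 0) (h' : (-W0) a ≠ 0), Projectivization.mk ℝ ((-W0) a) h' = Projectivization.mk ℝ (W0 a) h :=
        fun a h h' => (Projectivization.mk_eq_mk_iff' ℝ _ _ _ _).2 ⟨-1, by simp⟩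
      constructor
      · rintro ⟨a, ha, h1, rfl⟩
        have h2 : (-W0) a ≠ 0 := by simpa using h1
        exact ⟨a, ha, h2, (e a h1 h2).symm⟩
      · rintro ⟨a, ha, h2, rfl⟩
        have h1 : W0 a ≠ 0 := by simpa using h2
        exact ⟨a, ha, h1, e a h1 h2⟩

theorem closure_W {W : (Fin 3 → ℝ) →ₗ[ℝ] (Fin d → ℝ)} (hW : Function.Injective W) :
    closure (W '' {a | ∀ i, 0 < a i}) = W '' {a | ∀ i, 0 ≤ a i} := by
  have hc : Topology.IsClosedEmbedding W :=
    LinearMap.isClosedEmbedding_of_injective (LinearMap.ker_eq_bot.2 hW)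
  rw [hc.closure_image_eq]
  congr 1
  apply Subset.antisymm
  · refine closure_minimal (fun a ha i => (ha i).le) ?_
    have : {a : Fin 3 → ℝ | ∀ i, 0 ≤ a i} = ⋂ i, {a | 0 ≤ a i} := by ext; simp
    rw [this]
    exact isClosed_iInter fun i => isClosed_le continuous_const (continuous_apply i)
  · intro a ha
    have hl : Tendsto (fun n : ℕ => a + (1 / ((n : ℝ) + 1)) • (1 : Fin 3 → ℝ)) atTop (nhds (a + (0 : ℝ) • 1)) :=
      tendsto_const_nhds.add (tendsto_one_div_add_atTop_nhds_zero_nat.smul_const _)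
    rw [zero_smul, add_zero] at hl
    refine mem_closure_of_tendsto hl (Eventually.of_forall fun n i => ?_)
    have := ha i
    simp only [Pi.add_apply, Pi.smul_apply, Pi.one_apply, smul_eq_mul, mul_one]
    have : (0 : ℝ) < 1 / ((n : ℝ) + 1) := by positivity
    linarith

theorem closed_emb {A B : Set (PSpace d)} (h : IsProperlyEmbedded A B) : closure A ∩ B ⊆ A := by
  obtain ⟨hs, hp⟩ := h
  have h1 := hp.isClosedMap.isClosed_range
  obtain ⟨t, ht, hte⟩ := isClosed_induced_iff.1 h1
  rintro x ⟨hx, hxB⟩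
  have hAt : A ⊆ t := fun y hy => by
    have : (⟨y, hs hy⟩ : B) ∈ Subtype.val ⁻¹' t := by rw [hte]; exact ⟨⟨y, hy⟩, rfl⟩
    exact this
  have h2 : (⟨x, hxB⟩ : B) ∈ Subtype.val ⁻¹' t := closure_minimal hAt ht hx
  rw [hte] at h2
  obtain ⟨y, hy⟩ := h2
  have := congrArg Subtype.val hy
  dsimp at this
  rw [← this]; exact y.2

theorem eqv_comb {Θ : Cset d} {x y : Fin d → ℝ} (hx : x ∈ Θ.K) (hy : y ∈ Θ.K) {s t : ℝ} (hs : 0 < s) (ht : 0 < t) :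
    Θ.Eqv (s • x + t • y) (x + y) := by
  have k1 := Θ.Ksmul hs.le hx
  have k2 := Θ.Ksmul ht.le hy
  refine ⟨Cset.Le.add k1 k2 (Θ.smul_le hs (Θ.le_add_right hy)) (Θ.smul_le ht (Θ.le_add_left hx)), ?_⟩
  exact Cset.Le.add hx hy ((Θ.le_smul hs (Θ.le_refl x)).trans (Θ.le_add_right k2))
    ((Θ.le_smul ht (Θ.le_refl y)).trans (Θ.le_add_left k1))

theorem eqv_pos {Θ : Cset d} {x : Fin d → ℝ} {s : ℝ} (hs : 0 < s) : Θ.Eqv (s • x) x :=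
  ⟨Θ.smul_le hs (Θ.le_refl x), Θ.le_smul hs (Θ.le_refl x)⟩

theorem fin3_sum : ∀ i j k : Fin 3, i ≠ j → i ≠ k → j ≠ k → ∀ m : Fin 3, m = i ∨ m = j ∨ m = k := by decide

theorem fin3_other : ∀ k : Fin 3, ∃ i j : Fin 3, i ≠ j ∧ i ≠ k ∧ j ≠ k := by decide

theorem simplex_tri {S : Set (PSpace d)} (hS : IsSimplexOfDim 2 S) (hSsub : S ⊆ T.C)
    (hSpe : IsProperlyEmbedded S T.C) :
    ∃ e : Fin 3 → Fin d → ℝ, (toC T).Tri e ∧ ∀ z ∈ closure T.Ω,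
      (z ∈ ⋃ x ∈ closure S \ S, face T.Ω x) ↔ (toC T).InS e (cmap T.Ω z) := by
  have hSΩ := hSsub.trans T.C_sub
  obtain ⟨W, hW, hcone⟩ := simplex_param T hS hSΩ
  have hcl := closure_W hW
  rw [← hcone] at hcl
  have hKC : ∀ a : Fin 3 → ℝ, (∀ i, 0 ≤ a i) → W a ∈ (toC T).KC := by
    intro a ha
    have h1 : W a ∈ closure (coneOf (toC T).f S) := by rw [hcl]; exact ⟨a, ha, rfl⟩
    have h2 : coneOf (toC T).f S ⊆ coneOf (toC T).f T.C := fun v hv => ⟨hv.1, hv.2.1, hSsub hv.2.2⟩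
    exact closure_mono h2 h1
  have hne : ∀ a : Fin 3 → ℝ, a ≠ 0 → W a ≠ 0 := fun a ha h => ha (hW (by rw [h, map_zero]))
  have hI : ∀ a : Fin 3 → ℝ, (∀ i, 0 < a i) → W a ∈ (toC T).I := by
    intro a ha
    have : W a ∈ coneOf (toC T).f S := by rw [hcone]; exact ⟨a, ha, rfl⟩
    exact ⟨this.1, this.2.1, hSΩ this.2.2⟩
  have hbd : ∀ a : Fin 3 → ℝ, (∀ i, 0 ≤ a i) → (∃ k, a k = 0) → ∀ h : W a ≠ 0,
      Projectivization.mk ℝ (W a) h ∈ closure S \ S := by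
    rintro a ha ⟨k, hk⟩ h
    refine ⟨mk_mem T hSΩ h (by rw [hcl]; exact ⟨a, ha, rfl⟩), fun hs => ?_⟩
    have : W a ∈ coneOf (toC T).f S := ⟨(toC T).Kfpos ((toC T).KCsub (hKC a ha)) h, h, hs⟩
    rw [hcone] at this
    obtain ⟨b, hb, hab⟩ := this
    rw [hW hab] at hb
    exact (hb k).ne' hk
  have hnI : ∀ a : Fin 3 → ℝ, (∀ i, 0 ≤ a i) → (∃ k, a k = 0) → W a ∉ (toC T).I := by
    intro a ha hk hIa
    have h1 := hbd a ha hk hIa.2.1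
    have h2 := T.C_closedInΩ ⟨closure_mono hSsub h1.1, hIa.2.2⟩
    exact h1.2 (closed_emb hSpe ⟨h1.1, h2⟩)
  set s : Fin 3 → Fin 3 → ℝ := fun i => Pi.single i 1 with hs
  have hs0 : ∀ i m, 0 ≤ s i m := fun i m => by
    simp only [hs, Pi.single_apply]; split_ifs <;> norm_num
  have hs1 : ∀ i, s i i = 1 := fun i => by simp [hs]
  have hs2 : ∀ i k, i ≠ k → s i k = 0 := fun i k h => by simp [hs, h.symm]
  have hsne : ∀ i, s i ≠ 0 := fun i h => by have := hs1 i; rw [h] at this; simp at this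
  have hEK : ∀ i, W (s i) ∈ (toC T).K := fun i => (toC T).KCsub (hKC _ (hs0 i))
  refine ⟨fun i => W (s i), ⟨fun i => hKC _ (hs0 i), fun i => hne _ (hsne i), ?_, ?_⟩, ?_⟩
  · intro i j k hij hik hjk
    rw [← map_add, ← map_add]
    refine hI _ fun m => ?_
    simp only [Pi.add_apply]
    have h1 := hs0 i m
    have h2 := hs0 j m
    have h3 := hs0 k m
    rcases fin3_sum i j k hij hik hjk m with rfl | rfl | rfl
    · rw [hs1]; linarith
    · rw [hs1]; linarith
    · rw [hs1]; linarith
  · intro i j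
    rw [← map_add]
    obtain ⟨k, hik, hjk⟩ := Cset.exists_third i j
    refine hnI _ (fun m => add_nonneg (hs0 i m) (hs0 j m)) ⟨k, ?_⟩
    rw [Pi.add_apply, hs2 i k hik, hs2 j k hjk, add_zero]
  · intro z hz
    simp only [mem_iUnion, exists_prop]
    constructor
    · rintro ⟨x, hx, hzx⟩
      have hxΩ := closure_mono hSΩ hx.1
      have hE := (mem_face T hxΩ hz).1 hzx
      refine Cset.InS.of_eqv hE.symm ?_
      have h1 := cmap_mem T hSΩ hx.1
      rw [hcl] at h1
      obtain ⟨a, ha, hax⟩ := h1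
      have hk : ∃ k, a k = 0 := by
        by_contra! hcon
        apply hx.2
        have : cmap T.Ω x ∈ coneOf (toC T).f S := by
          rw [hcone, ← hax]
          exact ⟨a, fun i => lt_of_le_of_ne (ha i) (hcon i).symm, rfl⟩
        have h2 := this.2.2
        rwa [mk_cmap T hxΩ] at h2
      obtain ⟨k, hk⟩ := hk
      obtain ⟨i, j, hij, hik, hjk⟩ := fin3_other k
      have hdec : a = a i • s i + a j • s j := by
        ext m
        simp only [Pi.add_apply, Pi.smul_apply, smul_eq_mul]
        rcases fin3_sum i j k hij hik hjk m with rfl | rfl | rfl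
        · rw [hs1, hs2 j m hij.symm]; ring
        · rw [hs1, hs2 i m hij]; ring
        · rw [hs2 i m hik, hs2 j m hjk, hk]; ring
      have hWa : cmap T.Ω x = a i • W (s i) + a j • W (s j) := by
        rw [← hax]; conv_lhs => rw [hdec]
        simp
      rw [hWa]
      rcases (ha i).eq_or_lt with h1 | h1
      · rcases (ha j).eq_or_lt with h2 | h2
        · exfalso
          rw [← h1, ← h2] at hWa
          apply cmap_ne T hxΩ
          rw [hWa]; simp
        · rw [← h1, zero_smul, zero_add]
          exact Or.inl ⟨j, eqv_pos h2⟩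
      · rcases (ha j).eq_or_lt with h2 | h2
        · rw [← h2, zero_smul, add_zero]
          exact Or.inl ⟨i, eqv_pos h1⟩
        · exact Or.inr ⟨i, j, hij, eqv_comb (hEK i) (hEK j) h1 h2⟩
    · have fin : ∀ a : Fin 3 → ℝ, (∀ i, 0 ≤ a i) → (∃ k, a k = 0) → W a ≠ 0 → (toC T).Eqv (cmap T.Ω z) (W a) →
          ∃ x, x ∈ closure S \ S ∧ z ∈ face T.Ω x := by
        intro a ha hk h hE
        have haK := (toC T).KCsub (hKC a ha)
        refine ⟨_, hbd a ha hk h, ?_⟩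
        rw [mem_face T (mk_K T h haK) hz]
        exact (eqv_cmap T h haK).symm.trans hE.symm
      rintro (⟨i, hi⟩ | ⟨i, j, hij, hi⟩)
      · exact fin _ (hs0 i) ⟨i + 1, hs2 i _ (Cset.exists_next i)⟩ (hne _ (hsne i)) hi
      · obtain ⟨k, hik, hjk⟩ := Cset.exists_third i j
        refine fin (s i + s j) (fun m => add_nonneg (hs0 i m) (hs0 j m)) ⟨k, ?_⟩ ?_ ?_
        · rw [Pi.add_apply, hs2 i k hik, hs2 j k hjk, add_zero]
        · rw [map_add]; exact Cset.Kne (hEK i) (hEK j) (hne _ (hsne i))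
        · rw [map_add]; exact hi

end

/-- Lemma 7.4: if all faces of the ideal boundary of a naive convex
co-compact triple have coarse dimension at most one, a line segment in `∂_i C` meeting
`F_Ω(∂S)` for a properly embedded two-dimensional simplex `S ⊆ C` is contained in
`F_Ω(∂S)`. -/
theorem segment_meeting_face_union {d : ℕ} (T : NCCTriple d)
    (hcdim : ∀ x ∈ idealBdry T.C, cdim (face T.Ω x) (idealBdry T.C ∩ face T.Ω x) ≤ 1)
    (a b : PSpace d) (ha : a ∈ closure T.Ω) (hb : b ∈ closure T.Ω)
    (ℓ : Set (PSpace d)) (hℓ : ℓ = projSeg T.Ω a b) (hℓsub : ℓ ⊆ idealBdry T.C)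
    (S : Set (PSpace d)) (hS : IsSimplexOfDim 2 S) (hSsub : S ⊆ T.C)
    (hSpe : IsProperlyEmbedded S T.C)
    (hmeet : (ℓ ∩ ⋃ x ∈ closure S \ S, face T.Ω x).Nonempty) :
    ℓ ⊆ ⋃ x ∈ closure S \ S, face T.Ω x := by
  obtain ⟨e, htri, hiff⟩ := simplex_tri T hS hSsub hSpe
  have H := hyp T hcdim
  have Gr := grp T
  have haℓ : a ∈ ℓ := by rw [hℓ]; exact ⟨ha, left_mem_segment ℝ _ _⟩
  have hbℓ : b ∈ ℓ := by rw [hℓ]; exact ⟨hb, right_mem_segment ℝ _ _⟩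
  obtain ⟨-, hA, -⟩ := mem_idealBdry T (hℓsub haℓ)
  obtain ⟨-, hB, -⟩ := mem_idealBdry T (hℓsub hbℓ)
  have hA0 := cmap_ne T ha
  have hB0 := cmap_ne T hb
  have fA := f_cmap T ha
  have fB := f_cmap T hb
  have hAK := cmap_K T ha
  have hBK := cmap_K T hb
  have hABI : cmap T.Ω a + cmap T.Ω b ∉ (toC T).I := by
    intro hI
    have hz0 : cmap T.Ω a + cmap T.Ω b ≠ 0 := hI.2.1
    have hzΩ := hI.2.2
    have hzc : cmap T.Ω (Projectivization.mk ℝ _ hz0) = (2⁻¹ : ℝ) • (cmap T.Ω a + cmap T.Ω b) := by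
      rw [cmap_mk, map_add, fA, fB]; norm_num
    have hzℓ : Projectivization.mk ℝ _ hz0 ∈ ℓ := by
      rw [hℓ]
      refine ⟨subset_closure hzΩ, ?_⟩
      rw [hzc]
      exact ⟨2⁻¹, 2⁻¹, by norm_num, by norm_num, by norm_num, by rw [smul_add]⟩
    have h1 := (mem_idealBdry T (hℓsub hzℓ)).2.2
    rw [hzc] at h1
    exact h1 ((toC T).Ismul _ (by norm_num) _ hI)
  have hseg : ∀ z ∈ ℓ, (toC T).Eqv (cmap T.Ω z) (cmap T.Ω a) ∨ (toC T).Eqv (cmap T.Ω z) (cmap T.Ω b) ∨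
      (toC T).Eqv (cmap T.Ω z) (cmap T.Ω a + cmap T.Ω b) := by
    intro z hz
    rw [hℓ] at hz
    obtain ⟨-, s, t, hs, ht, hst, h⟩ := hz
    rw [← h]
    rcases hs.eq_or_lt with h1 | h1
    · have : t = 1 := by linarith
      right; left
      rw [← h1, this, zero_smul, zero_add]; exact eqv_pos one_pos
    · rcases ht.eq_or_lt with h2 | h2
      · have : s = 1 := by linarith
        left
        rw [← h2, this, zero_smul, add_zero]; exact eqv_pos one_pos
      · right; right; exact eqv_comb hAK hBK h1 h2
  have hAB : (toC T).InS e (cmap T.Ω a + cmap T.Ω b) := by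
    obtain ⟨z, hz, hzS⟩ := hmeet
    have hzΩ := (mem_idealBdry T (hℓsub hz)).1
    have hzi := (hiff z hzΩ).1 hzS
    rcases hseg z hz with h | h | h
    · exact Cset.step2 H Gr htri hA hB hA0 hABI (hzi.of_eqv h.symm)
    · rw [add_comm]
      exact Cset.step2 H Gr htri hB hA hB0 (by rwa [add_comm]) (hzi.of_eqv h.symm)
    · exact hzi.of_eqv h.symm
  intro z hz
  have hzΩ := (mem_idealBdry T (hℓsub hz)).1
  rw [hiff z hzΩ]
  rcases hseg z hz with h | h | h
  · exact (Cset.step1 H htri hA hB hA0 hAB).of_eqv h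
  · exact (Cset.step1 H htri hB hA hB0 (by rwa [add_comm])).of_eqv h
  · exact hAB.of_eqv h

end Paper
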